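/- arXiv:1407.6259 — 3 statements merged into one kernel-verified Lean document; each statement's English description precedes it below -/
import Mathlib

section
/- Let ψ : ℝ × ℝ³ → ℝ³ be a C^∞ flow, i.e. ψ is C^∞, ψ(0, p) = p and ψ(σ + τ, p) = ψ(σ, ψ(τ, p)) for all σ, τ ∈ ℝ, p ∈ ℝ³. Write points of ℝ³ as (t, s, r), let V := ℝ × {0} × (0, ∞), and let X : ℝ³ → ℝ³, X(p) := (∂/∂τ)|_{τ=0} ψ(τ, p), denote the generating vector field, with components X = (X_t, X_s, X_r). Assume: (1) ψ(τ, (t, 0, 0)) = (t + τ, 0, 0) for all τ, t ∈ ℝ; (2) X_s(p) ≠ 0 for every p ∈ V, there is a constant C > 0 such that for every p ∈ V the set {σ > 0 : ψ(σ, p) ∈ V} has a least element τ(p) and τ(p) ≤ C, and the first-return time function (t, r) ↦ τ(t, 0, r) is C^∞ on ℝ × (0, ∞); (3) (∂/∂r)|_{r=0} X_s(t, 0, r) ≠ 0 for every t ∈ ℝ. Then the first-return time extends smoothly to the closure of V: there exist an open set U ⊆ ℝ² containing ℝ × [0, ∞) and a C^∞ function τ̄ : U → ℝ such that τ̄(t,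 r) = τ(t, 0, r) for all t ∈ ℝ and r > 0. -/
open Filter Topology Set MeasureTheory
open scoped ContDiff Manifold

/-- Integrating a `C^n` family over the unit interval gives a `C^n` function of the parameter. -/
theorem contDiff_nat_integral_unitInterval {E : Type} [NormedAddCommGroup E] [NormedSpace ℝ E]
    [FiniteDimensional ℝ E] (n : ℕ) :
    ∀ {F : Type} [NormedAddCommGroup F] [NormedSpace ℝ F] {f : E × ℝ → F},
      ContDiff ℝ ∞ f → ContDiff ℝ n (fun x => ∫ u in (0 : ℝ)..1, f (x, u)) := by
  induction n with
  | zero =>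
    intro F _ _ f hf
    rw [Nat.cast_zero, contDiff_zero]
    exact intervalIntegral.continuous_parametric_intervalIntegral_of_continuous'
      (f := fun x u => f (x, u)) hf.continuous 0 1
  | succ n ih =>
    intro F _ _ f hf
    have hf' : ContDiff ℝ ∞
        (fun p : E × ℝ => (fderiv ℝ f p).comp (ContinuousLinearMap.inl ℝ E ℝ)) :=
      (hf.fderiv_right (m := ∞) (by simp)).clm_comp contDiff_const
    have hd : ∀ (u : ℝ) (x : E), HasFDerivAt (fun x => f (x, u))
        ((fderiv ℝ f (x, u)).comp (ContinuousLinearMap.inl ℝ E ℝ)) x := fun u x =>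
      ((hf.differentiable (by simp)) (x, u)).hasFDerivAt.comp x (hasFDerivAt_prodMk_left x u)
    have key : ∀ x₀ : E, HasFDerivAt (fun x => ∫ u in (0 : ℝ)..1, f (x, u))
        (∫ u in (0 : ℝ)..1, (fderiv ℝ f (x₀, u)).comp (ContinuousLinearMap.inl ℝ E ℝ)) x₀ := by
      intro x₀
      have hK : IsCompact (Metric.closedBall x₀ 1 ×ˢ Icc (0 : ℝ) 1) :=
        (isCompact_closedBall x₀ 1).prod isCompact_Icc
      obtain ⟨B, hB⟩ := hK.exists_bound_of_continuousOn hf'.continuous.continuousOn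
      have hc : ∀ x : E, Continuous fun u : ℝ => f (x, u) := fun x =>
        hf.continuous.comp (by fun_prop)
      have hc' : Continuous fun u : ℝ =>
          (fderiv ℝ f (x₀, u)).comp (ContinuousLinearMap.inl ℝ E ℝ) :=
        hf'.continuous.comp (g := fun p : E × ℝ =>
          (fderiv ℝ f p).comp (ContinuousLinearMap.inl ℝ E ℝ)) (by fun_prop)
      refine (intervalIntegral.hasFDerivAt_integral_of_dominated_of_fderiv_le
        (F := fun x u => f (x, u)) (bound := fun _ => B)
        (F' := fun x u => (fderiv ℝ f (x, u)).comp (ContinuousLinearMap.inl ℝ E ℝ))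
        (Metric.closedBall_mem_nhds x₀ one_pos) ?_ ?_ ?_ ?_ ?_ ?_)
      · exact Eventually.of_forall fun x => (hc x).aestronglyMeasurable
      · exact (hc x₀).intervalIntegrable _ _
      · exact hc'.aestronglyMeasurable
      · refine Eventually.of_forall fun u hu x hx => hB (x, u) ⟨hx, ?_⟩
        rw [uIoc_of_le zero_le_one] at hu
        exact ⟨hu.1.le, hu.2⟩
      · exact intervalIntegrable_const
      · exact Eventually.of_forall fun u _ x _ => hd u x
    rw [Nat.cast_add, Nat.cast_one, contDiff_succ_iff_fderiv]
    refine ⟨fun x => (key x).differentiableAt, by simp, ?_⟩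
    rw [show fderiv ℝ (fun x => ∫ u in (0 : ℝ)..1, f (x, u)) = fun x => ∫ u in (0 : ℝ)..1,
      (fderiv ℝ f (x, u)).comp (ContinuousLinearMap.inl ℝ E ℝ) from
        funext fun x => (key x).fderiv]
    exact ih hf'

/-- Hadamard's lemma: a smooth function vanishing on `r = 0` is `r` times a smooth function. -/
theorem exists_contDiff_eq_mul {E : Type} [NormedAddCommGroup E] [NormedSpace ℝ E]
    [FiniteDimensional ℝ E] {f : E × ℝ → ℝ} (hf : ContDiff ℝ ∞ f) (h0 : ∀ x, f (x, 0) = 0) :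
    ∃ g : E × ℝ → ℝ, ContDiff ℝ ∞ g ∧ ∀ x r, f (x, r) = r * g (x, r) := by
  have hsm : ContDiff ℝ ∞ (fun p : (E × ℝ) × ℝ => fderiv ℝ f (p.1.1, p.2 * p.1.2) (0, 1)) :=
    ((hf.fderiv_right (m := ∞) (by simp)).comp
      (f := fun p : (E × ℝ) × ℝ => (p.1.1, p.2 * p.1.2)) (by fun_prop)).clm_apply contDiff_const
  refine ⟨fun q => ∫ u in (0 : ℝ)..1, fderiv ℝ f (q.1, u * q.2) (0, 1), ?_, ?_⟩
  · exact contDiff_infty.2 fun n => contDiff_nat_integral_unitInterval n hsm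
  · intro x r
    have hd : ∀ u ∈ uIcc (0 : ℝ) 1, HasDerivAt (fun u : ℝ => f (x, u * r))
        (r * fderiv ℝ f (x, u * r) (0, 1)) u := by
      intro u _
      have h1 : HasDerivAt (fun u : ℝ => (x, u * r)) ((0 : E), r) u := by
        simpa using (hasDerivAt_const u x).prodMk ((hasDerivAt_id u).mul_const r)
      have h2 := ((hf.differentiable (by simp)) (x, u * r)).hasFDerivAt.comp_hasDerivAt u h1
      have h3 : ((0 : E), r) = r • ((0 : E), (1 : ℝ)) := by simp
      rw [h3, map_smul, smul_eq_mul] at h2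
      exact h2
    have hc : Continuous fun u : ℝ => r * fderiv ℝ f (x, u * r) (0, 1) :=
      continuous_const.mul (hsm.continuous.comp (g := fun p : (E × ℝ) × ℝ =>
        fderiv ℝ f (p.1.1, p.2 * p.1.2) (0, 1)) (f := fun u : ℝ => ((x, r), u)) (by fun_prop))
    have := intervalIntegral.integral_eq_sub_of_hasDerivAt hd (hc.intervalIntegrable 0 1)
    rw [intervalIntegral.integral_const_mul] at this
    simpa [h0] using this.symm

/-- The derivative at `0` of `r ↦ r * k r`, for `k` continuous at `0`. -/
theorem hasDerivAt_id_mul_of_continuousAt {k : ℝ → ℝ} (hk : ContinuousAt k 0) :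
    HasDerivAt (fun r => r * k r) (k 0) 0 := by
  rw [hasDerivAt_iff_tendsto_slope]
  refine (hk.tendsto.mono_left nhdsWithin_le_nhds).congr' ?_
  filter_upwards [self_mem_nhdsWithin] with r hr
  have hr : r ≠ 0 := hr
  simp [slope_def_field, hr]

/-- The implicit function theorem at a simple zero, with smoothness on a whole neighbourhood. -/
theorem exists_smooth_implicit_zero {E : Type} [NormedAddCommGroup E] [NormedSpace ℝ E]
    [CompleteSpace E] {f : E × ℝ → ℝ} (hf : ContDiff ℝ ∞ f) {q₀ : E} {σ : ℝ}
    (h0 : f (q₀, σ) = 0) (hd : fderiv ℝ f (q₀, σ) (0, 1) ≠ 0) :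
    ∃ T : E → ℝ, T q₀ = σ ∧ (∀ᶠ q in 𝓝 q₀, ContDiffAt ℝ ∞ T q) ∧
      (∀ᶠ q in 𝓝 q₀, f (q, T q) = 0) ∧ ∀ᶠ v in 𝓝 (q₀, σ), f v = 0 → T v.1 = v.2 := by
  have hinv : ∀ u : E × ℝ, fderiv ℝ f u (0, 1) ≠ 0 →
      (fderiv ℝ f u ∘L .inr ℝ E ℝ).IsInvertible := by
    intro u hu
    refine ⟨ContinuousLinearEquiv.unitsEquivAut ℝ (Units.mk0 _ hu), ?_⟩
    ext
    simp
  have hn : (∞ : WithTop ℕ∞) ≠ 0 := by simp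
  have hfu : ∀ u, ContDiffAt ℝ ∞ f u := fun u => hf.contDiffAt
  set T := (hfu (q₀, σ)).implicitFunction hn (hinv _ hd) with hT
  have hTq : T q₀ = σ := (hfu (q₀, σ)).implicitFunction_apply_self hn (hinv _ hd)
  have hT0 : ∀ᶠ q in 𝓝 q₀, f (q, T q) = 0 := by
    have := (hfu (q₀, σ)).eventually_apply_implicitFunction hn (hinv _ hd)
    rwa [h0] at this
  have hTs : ContDiffAt ℝ ∞ T q₀ := (hfu (q₀, σ)).contDiffAt_implicitFunction hn (hinv _ hd)
  refine ⟨T, hTq, ?_, hT0, ?_⟩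
  · have hcont : ∀ᶠ q in 𝓝 q₀, ContinuousAt T q :=
      ((hTs.of_le (m := 1) (by simp)).eventually (by simp)).mono fun q hq => hq.continuousAt
    have hne : ∀ᶠ q in 𝓝 q₀, fderiv ℝ f (q, T q) (0, 1) ≠ 0 := by
      have hc : ContinuousAt (fun q => fderiv ℝ f (q, T q) (0, 1)) q₀ :=
        ((hf.continuous_fderiv (by simp)).clm_apply continuous_const).continuousAt.comp
          (f := fun q => (q, T q)) (continuousAt_id.prodMk hTs.continuousAt)
      refine hc.eventually_ne ?_
      rwa [hTq]
    filter_upwards [hcont, hne, hT0.eventually_nhds] with q hcq hneq hzq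
    have hu := (hfu (q, T q)).contDiffAt_implicitFunction hn (hinv _ hneq)
    refine hu.congr_of_eventuallyEq ?_
    have hev := (hfu (q, T q)).eventually_apply_eq_iff_implicitFunction hn (hinv _ hneq)
    have htend : Tendsto (fun x => (x, T x)) (𝓝 q) (𝓝 (q, T q)) :=
      continuousAt_id.prodMk hcq
    filter_upwards [htend.eventually hev, hzq] with x hx hzx
    exact (hx.1 (hzx.trans hzq.self_of_nhds.symm)).symm
  · have := (hfu (q₀, σ)).eventually_apply_eq_iff_implicitFunction hn (hinv _ hd)
    filter_upwards [this] with v hv hv0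
    exact hv.1 (hv0.trans h0.symm)

/-- Consider the positive solutions `σ` of `f (q, σ) = 0`, `0 < h (q, σ)`, where `q` approaches
`q₀` along `l`. If a bounded function `ρ` selects the least one, and the zeros of `f (q₀, ·)` are
simple and not zeros of `h (q₀, ·)`, then `ρ` agrees along `l` with a function that is smooth
near `q₀`. -/
theorem exists_smooth_eventuallyEq_of_least_zero {E : Type} [NormedAddCommGroup E]
    [NormedSpace ℝ E] [CompleteSpace E] {f h : E × ℝ → ℝ} (hf : ContDiff ℝ ∞ f)
    (hh : Continuous h) {q₀ : E} {l : Filter E} [l.NeBot] (hl : l ≤ 𝓝 q₀)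
    (hsimple : ∀ σ, f (q₀, σ) = 0 → fderiv ℝ f (q₀, σ) (0, 1) ≠ 0)
    (hne : ∀ σ, f (q₀, σ) = 0 → h (q₀, σ) ≠ 0)
    (hf0 : ∀ᶠ q in l, f (q, 0) = 0) {ρ : E → ℝ} {C : ℝ}
    (hρ : ∀ᶠ q in l, 0 < ρ q ∧ ρ q ≤ C ∧ f (q, ρ q) = 0 ∧ 0 < h (q, ρ q))
    (hleast : ∀ᶠ q in l, ∀ σ, 0 < σ → f (q, σ) = 0 → 0 < h (q, σ) → ρ q ≤ σ) :
    ∃ T : E → ℝ, (∀ᶠ q in 𝓝 q₀, ContDiffAt ℝ ∞ T q) ∧ ∀ᶠ q in l, T q = ρ q := by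
  have hf00 : f (q₀, 0) = 0 := by
    have hc : Tendsto (fun q => f (q, 0)) l (𝓝 (f (q₀, 0))) :=
      ((hf.continuous.comp
        (by fun_prop : Continuous fun q : E => (q, (0 : ℝ)))).tendsto q₀).mono_left hl
    exact tendsto_nhds_unique (hc.congr' hf0) tendsto_const_nhds
  obtain ⟨ε, hε, hρε⟩ : ∃ ε > 0, ∀ᶠ q in l, ε ≤ ρ q := by
    obtain ⟨T, -, -, -, hT⟩ := exists_smooth_implicit_zero hf hf00 (hsimple 0 hf00)
    rw [nhds_prod_eq] at hT
    obtain ⟨P, hP, Q, hQ, hPQ⟩ := eventually_prod_iff.1 hT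
    obtain ⟨ε, hε, hεQ⟩ := Metric.eventually_nhds_iff.1 hQ
    refine ⟨ε, hε, ?_⟩
    filter_upwards [hf0, hρ, hl hP] with q hq hρq hPq
    by_contra! hlt
    have e1 := hPQ hPq (hεQ (y := ρ q) (by
      rw [Real.dist_eq, sub_zero, abs_of_pos hρq.1]; exact hlt)) hρq.2.2.1
    have e2 := hPQ hPq (hεQ (y := 0) (by simpa using hε)) hq
    have : ρ q = 0 := e1.symm.trans e2
    exact hρq.1.ne' this
  have hρK : ∀ᶠ q in l, ρ q ∈ Icc ε C := by
    filter_upwards [hρε, hρ] with q h1 h2 using ⟨h1, h2.2.1⟩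
  have hfreq : ∀ {σ : ℝ}, MapClusterPt σ l ρ → ∀ {P : E × ℝ → Prop},
      (∀ᶠ v in 𝓝 (q₀, σ), P v) → ∃ᶠ q in l, P (q, ρ q) := by
    intro σ hσ P hP
    rw [nhds_prod_eq] at hP
    obtain ⟨P₁, hP₁, P₂, hP₂, hPP⟩ := eventually_prod_iff.1 hP
    exact ((mapClusterPt_iff_frequently.1 hσ _ hP₂).and_eventually (hl hP₁)).mono
      fun q hq => hPP hq.2 hq.1
  have hzero : ∀ {σ : ℝ}, MapClusterPt σ l ρ → f (q₀, σ) = 0 := by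
    intro σ hσ
    by_contra hcon
    obtain ⟨q, hq1, hq2⟩ :=
      ((hfreq hσ (hf.continuous.continuousAt.eventually_ne hcon)).and_eventually hρ).exists
    exact hq1 hq2.2.2.1
  have hpos : ∀ {σ : ℝ}, MapClusterPt σ l ρ → 0 < h (q₀, σ) := by
    intro σ hσ
    refine lt_of_le_of_ne ?_ (hne σ (hzero hσ)).symm
    by_contra! hcon
    obtain ⟨q, hq1, hq2⟩ :=
      ((hfreq hσ (hh.continuousAt.eventually_lt_const hcon)).and_eventually hρ).exists
    exact lt_asymm hq1 hq2.2.2.2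
  have hle : ∀ {σ σ' : ℝ}, σ ∈ Icc ε C → MapClusterPt σ l ρ → MapClusterPt σ' l ρ → σ' ≤ σ := by
    intro σ σ' hσI hσ hσ'
    obtain ⟨T, hTq, hTs, hT0, -⟩ :=
      exists_smooth_implicit_zero hf (hzero hσ) (hsimple σ (hzero hσ))
    have hTc : Tendsto T (𝓝 q₀) (𝓝 σ) := by
      have := hTs.self_of_nhds.continuousAt.tendsto
      rwa [hTq] at this
    have hTh : ∀ᶠ q in 𝓝 q₀, 0 < h (q, T q) := by
      have ht : Tendsto (fun q => h (q, T q)) (𝓝 q₀) (𝓝 (h (q₀, σ))) :=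
        (hh.tendsto (q₀, σ)).comp (tendsto_id.prodMk_nhds hTc)
      exact ht.eventually_const_lt (hpos hσ)
    have hρT : ∀ᶠ q in l, ρ q ≤ T q := by
      filter_upwards [hleast, hl hT0, hl hTh, hl (hTc.eventually_const_lt (hε.trans_le hσI.1))]
        with q h1 h2 h3 h4 using h1 _ h4 h2 h3
    by_contra! hlt
    obtain ⟨m, hm1, hm2⟩ := exists_between hlt
    obtain ⟨q, hq1, hq2, hq3⟩ := ((mapClusterPt_iff_frequently.1 hσ' _
      (lt_mem_nhds hm2)).and_eventually (hρT.and (hl (hTc.eventually_lt_const hm1)))).exists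
    exact absurd (hq2.trans_lt hq3) (not_lt.2 (le_of_lt hq1))
  obtain ⟨σ, hσI, hσ⟩ := isCompact_Icc.exists_mapClusterPt (f := l) (u := ρ)
    (tendsto_principal.2 hρK)
  have hρσ : Tendsto ρ l (𝓝 σ) :=
    isCompact_Icc.tendsto_nhds_of_unique_mapClusterPt hρK fun σ' hσ'I hσ' =>
      le_antisymm (hle hσI hσ hσ') (hle hσ'I hσ' hσ)
  obtain ⟨T, -, hTs, -, hTu⟩ :=
    exists_smooth_implicit_zero hf (hzero hσ) (hsimple σ (hzero hσ))
  refine ⟨T, hTs, ?_⟩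
  have ht : Tendsto (fun q => (q, ρ q)) l (𝓝 (q₀, σ)) :=
    (tendsto_id'.2 hl).prodMk_nhds hρσ
  filter_upwards [ht.eventually hTu, hρ] with q hq1 hq2 using hq1 hq2.2.2.1

/-- A function on the open half plane that is smooth and extends smoothly across each boundary
point extends to a smooth function on the plane. -/
theorem exists_contDiff_extension_of_local {ρ : ℝ × ℝ → ℝ}
    (hρ : ContDiffOn ℝ ∞ ρ {q : ℝ × ℝ | 0 < q.2})
    (hloc : ∀ t : ℝ, ∃ T : ℝ × ℝ → ℝ, (∀ᶠ q in 𝓝 (t, (0 : ℝ)), ContDiffAt ℝ ∞ T q) ∧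
      ∀ᶠ q in 𝓝[{q : ℝ × ℝ | 0 < q.2}] (t, (0 : ℝ)), T q = ρ q) :
    ∃ g : ℝ × ℝ → ℝ, ContDiff ℝ ∞ g ∧ ∀ q : ℝ × ℝ, 0 < q.2 → g q = ρ q := by
  obtain ⟨g, hg⟩ := exists_contMDiffMap_forall_mem_convex_of_local (n := (⊤ : ℕ∞))
    𝓘(ℝ, ℝ × ℝ) (t := fun q : ℝ × ℝ => {y : ℝ | 0 < q.2 → y = ρ q})
    (fun q => by
      by_cases hq : 0 < q.2
      · simp [hq, convex_singleton]
      · simp [hq, convex_univ])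
    (fun q => by
      rcases lt_trichotomy q.2 0 with hq | hq | hq
      · exact ⟨{q | q.2 < 0}, (isOpen_lt continuous_snd continuous_const).mem_nhds hq,
          fun _ => 0, contMDiffOn_const, fun y hy hy' => absurd hy (not_lt.2 hy'.le)⟩
      · obtain ⟨t, r⟩ := q
        obtain rfl : r = 0 := hq
        obtain ⟨T, hT, hTρ⟩ := hloc t
        rw [eventually_nhdsWithin_iff] at hTρ
        refine ⟨{q | ContDiffAt ℝ ∞ T q ∧ (0 < q.2 → T q = ρ q)}, hT.and hTρ, T, ?_,
          fun y hy => hy.2⟩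
        exact ContDiffOn.contMDiffOn fun y hy => hy.1.contDiffWithinAt
      · exact ⟨_, (isOpen_lt continuous_const continuous_snd).mem_nhds hq, ρ,
          hρ.contMDiffOn, fun y _ _ => rfl⟩)
  exact ⟨g, g.contMDiff.contDiff, fun q hq => hg q hq⟩


/-- Lemma 4.4 (`lemma umberto`): for a smooth flow `ψ` on `ℝ³` with coordinates `(t, s, r)`
which translates along the orbit `γ(τ) = (τ,0,0)`, is transverse to
`V = ℝ × {0} × (0,∞)` with uniformly bounded smooth first-return time `ret`, and satisfies
`∂ᵣ|_{r=0} X_s(t,0,r) ≠ 0`, the first-return time extends to a `C^∞` function on a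
neighborhood of the closure `ℝ × [0,∞)`. -/
theorem first_return_time_extends_smoothly
    (ψ : ℝ × (ℝ × ℝ × ℝ) → ℝ × ℝ × ℝ)
    (hψ : ContDiff ℝ (⊤ : ℕ∞) ψ)
    (hflow0 : ∀ p : ℝ × ℝ × ℝ, ψ (0, p) = p)
    (hflow : ∀ σ τ : ℝ, ∀ p : ℝ × ℝ × ℝ, ψ (σ + τ, p) = ψ (σ, ψ (τ, p)))
    (V : Set (ℝ × ℝ × ℝ)) (hV : V = {p : ℝ × ℝ × ℝ | p.2.1 = 0 ∧ 0 < p.2.2})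
    (X : (ℝ × ℝ × ℝ) → ℝ × ℝ × ℝ)
    (hX : ∀ p : ℝ × ℝ × ℝ, X p = deriv (fun τ : ℝ => ψ (τ, p)) 0)
    -- (1) `γ(τ) = (τ, 0, 0)` is an orbit of the flow
    (h1 : ∀ τ t : ℝ, ψ (τ, (t, 0, 0)) = (t + τ, 0, 0))
    -- (2) transversality and existence of a uniformly bounded, smooth first-return time
    (h2trans : ∀ p ∈ V, (X p).2.1 ≠ 0)
    (ret : (ℝ × ℝ × ℝ) → ℝ) (C : ℝ) (hC : 0 < C)
    (h2ret : ∀ p ∈ V, IsLeast {σ : ℝ | 0 < σ ∧ ψ (σ, p) ∈ V} (ret p) ∧ ret p ≤ C)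
    (h2smooth : ContDiffOn ℝ (⊤ : ℕ∞) (fun q : ℝ × ℝ => ret (q.1, 0, q.2))
      {q : ℝ × ℝ | 0 < q.2})
    -- (3) non-degeneracy of the vector field along the boundary orbit
    (h3 : ∀ t : ℝ, deriv (fun r : ℝ => (X (t, 0, r)).2.1) 0 ≠ 0) :
    ∃ U : Set (ℝ × ℝ), IsOpen U ∧ {q : ℝ × ℝ | 0 ≤ q.2} ⊆ U ∧
      ∃ τbar : ℝ × ℝ → ℝ, ContDiffOn ℝ (⊤ : ℕ∞) τbar U ∧
        ∀ t r : ℝ, 0 < r → τbar (t, r) = ret (t, 0, r) := by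
  have hψd : ∀ τ p, DifferentiableAt ℝ (fun x => ψ (τ, x)) p := fun τ p =>
    (hψ.comp (by fun_prop : ContDiff ℝ (⊤ : ℕ∞) fun x : ℝ × ℝ × ℝ => (τ, x))).differentiable
      (by simp) p
  have hψ' : ContDiff ℝ ∞ (fun v : (ℝ × ℝ) × ℝ => (ψ (v.1.2, (v.1.1, 0, v.2))).2) :=
    (hψ.comp (f := fun v : (ℝ × ℝ) × ℝ => (v.1.2, (v.1.1, (0 : ℝ), v.2)))
      (by fun_prop)).snd
  obtain ⟨g, hg, hgs⟩ := exists_contDiff_eq_mul hψ'.fst (by simp [h1])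
  obtain ⟨k, hk, hkr⟩ := exists_contDiff_eq_mul hψ'.snd (by simp [h1])
  replace hgs : ∀ t τ r, (ψ (τ, (t, 0, r))).2.1 = r * g ((t, τ), r) := fun t τ r => hgs (t, τ) r
  replace hkr : ∀ t τ r, (ψ (τ, (t, 0, r))).2.2 = r * k ((t, τ), r) := fun t τ r => hkr (t, τ) r
  -- the linearised flow along the boundary orbit
  have hAr : ∀ τ t, (fderiv ℝ (fun x => ψ (τ, x)) (t, 0, 0) (0, 0, 1)).2 =
      (g ((t, τ), 0), k ((t, τ), 0)) := by
    intro τ t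
    have hline : HasDerivAt (fun r : ℝ => (t, (0 : ℝ), r)) (0, 0, 1) 0 :=
      (hasDerivAt_const _ _).prodMk ((hasDerivAt_const _ _).prodMk (hasDerivAt_id _))
    have hcomp := (ContinuousLinearMap.snd ℝ ℝ (ℝ × ℝ)).hasFDerivAt.comp_hasDerivAt (0 : ℝ)
      ((hψd τ (t, 0, 0)).hasFDerivAt.comp_hasDerivAt (0 : ℝ) hline)
    have hgk : HasDerivAt (fun r : ℝ => (r * g ((t, τ), r), r * k ((t, τ), r)))
        (g ((t, τ), 0), k ((t, τ), 0)) 0 :=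
      (hasDerivAt_id_mul_of_continuousAt
        (hg.continuous.comp (by fun_prop : Continuous fun r : ℝ => ((t, τ), r))).continuousAt).prodMk
      (hasDerivAt_id_mul_of_continuousAt
        (hk.continuous.comp (by fun_prop : Continuous fun r : ℝ => ((t, τ), r))).continuousAt)
    refine hcomp.unique (hgk.congr_of_eventuallyEq (Eventually.of_forall fun r => ?_))
    exact Prod.ext (hgs t τ r) (hkr t τ r)
  have hAt : ∀ τ t, (fderiv ℝ (fun x => ψ (τ, x)) (t, 0, 0) (1, 0, 0)).2 = 0 := by
    intro τ t
    have hline : HasDerivAt (fun r : ℝ => (r, (0 : ℝ), (0 : ℝ))) (1, 0, 0) t :=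
      (hasDerivAt_id _).prodMk (hasDerivAt_const _ _)
    have hcomp := (ContinuousLinearMap.snd ℝ ℝ (ℝ × ℝ)).hasFDerivAt.comp_hasDerivAt t
      ((hψd τ (t, 0, 0)).hasFDerivAt.comp_hasDerivAt t hline)
    refine hcomp.unique ((hasDerivAt_const t (0 : ℝ × ℝ)).congr_of_eventuallyEq
      (Eventually.of_forall fun r => ?_))
    simp [h1]
  have hcocycle : ∀ t σ τ, g ((t, σ), 0) = 0 → (g ((t, σ + τ), 0), k ((t, σ + τ), 0)) =
      k ((t, σ), 0) • (g ((t + σ, τ), 0), k ((t + σ, τ), 0)) := by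
    intro t σ τ h0
    have hfl : (fun x => ψ (σ + τ, x)) = (fun x => ψ (τ, x)) ∘ fun x => ψ (σ, x) := by
      funext x
      simp [add_comm σ τ, hflow]
    have hA : fderiv ℝ (fun x => ψ (σ, x)) (t, 0, 0) (0, 0, 1) =
        (fderiv ℝ (fun x => ψ (σ, x)) (t, 0, 0) (0, 0, 1)).1 • ((1 : ℝ), (0 : ℝ), (0 : ℝ)) +
          k ((t, σ), 0) • ((0 : ℝ), (0 : ℝ), (1 : ℝ)) := by
      refine Prod.ext (by simp) ?_
      rw [hAr, h0]
      simp
    rw [← hAr, ← hAr, hfl, fderiv_comp _ (hψd _ _) (hψd _ _), ContinuousLinearMap.comp_apply,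
      hA, h1, map_add, map_smul, map_smul, Prod.snd_add, Prod.smul_snd, Prod.smul_snd, hAt,
      smul_zero, zero_add]
  have hk0 : ∀ t σ, g ((t, σ), 0) = 0 → k ((t, σ), 0) ≠ 0 := by
    intro t σ h0 hk0
    have h2 := hcocycle t σ (-σ) h0
    rw [hk0, zero_smul, add_neg_cancel, ← hAr, show (fun x => ψ (0, x)) = id from funext hflow0,
      fderiv_id] at h2
    simpa using congrArg Prod.snd h2
  set f : (ℝ × ℝ) × ℝ → ℝ := fun v => g ((v.1.1, v.2), v.1.2) with hfdef
  have hf : ContDiff ℝ ∞ f := hg.comp (by fun_prop)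
  have hfτ : ∀ t r σ, HasDerivAt (fun τ => g ((t, τ), r)) (fderiv ℝ f ((t, r), σ) (0, 1)) σ := by
    intro t r σ
    have hline : HasDerivAt (fun τ : ℝ => ((t, r), τ)) (0, 1) σ :=
      (hasDerivAt_const _ _).prodMk (hasDerivAt_id _)
    exact ((hf.differentiable (by simp)) ((t, r), σ)).hasFDerivAt.comp_hasDerivAt σ hline
  have hd0 : ∀ t, fderiv ℝ f ((t, 0), 0) (0, 1) ≠ 0 := by
    intro t
    have hXs : (fun r : ℝ => (X (t, 0, r)).2.1) =
        fun r => r * fderiv ℝ f ((t, r), 0) (0, 1) := by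
      funext r
      have hdiff : DifferentiableAt ℝ (fun τ => ψ (τ, (t, 0, r))) 0 :=
        (hψ.comp (by fun_prop : ContDiff ℝ (⊤ : ℕ∞) fun τ : ℝ => (τ, (t, (0 : ℝ), r)))).differentiable
          (by simp) 0
      rw [hX]
      have hcomp := ((ContinuousLinearMap.fst ℝ ℝ ℝ).comp
        (ContinuousLinearMap.snd ℝ ℝ (ℝ × ℝ))).hasFDerivAt.comp_hasDerivAt (0 : ℝ) hdiff.hasDerivAt
      refine hcomp.unique ?_
      exact ((hfτ t r 0).const_mul r).congr_of_eventuallyEq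
        (Eventually.of_forall fun τ => hgs t τ r)
    have hcont : Continuous fun r : ℝ => fderiv ℝ f ((t, r), 0) (0, 1) :=
      ((hf.continuous_fderiv (by simp)).comp
        (by fun_prop : Continuous fun r : ℝ => ((t, r), (0 : ℝ)))).clm_apply continuous_const
    have h3t := h3 t
    rwa [hXs, (hasDerivAt_id_mul_of_continuousAt hcont.continuousAt).deriv] at h3t
  have hsimple : ∀ t σ, f ((t, 0), σ) = 0 → fderiv ℝ f ((t, 0), σ) (0, 1) ≠ 0 := by
    intro t σ h0
    have hshift : HasDerivAt (fun τ => g ((t, σ + τ), 0)) (fderiv ℝ f ((t, 0), σ) (0, 1)) 0 := by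
      refine HasDerivAt.comp_const_add (f := fun τ => g ((t, τ), 0)) σ 0 ?_
      rw [add_zero]
      exact hfτ t 0 σ
    have hmul := (hfτ (t + σ) 0 0).const_mul (k ((t, σ), 0))
    have heq : (fun τ => g ((t, σ + τ), 0)) = fun τ => k ((t, σ), 0) * g ((t + σ, τ), 0) :=
      funext fun τ => congrArg Prod.fst (hcocycle t σ τ h0)
    rw [heq] at hshift
    rw [hshift.unique hmul]
    exact mul_ne_zero (hk0 t σ h0) (hd0 _)
  have hmem : ∀ t r σ, 0 < r →
      (ψ (σ, (t, 0, r)) ∈ V ↔ f ((t, r), σ) = 0 ∧ 0 < k ((t, σ), r)) := by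
    intro t r σ hr
    rw [hV, mem_ofPred_eq, hgs, hkr, mul_eq_zero, mul_pos_iff_of_pos_left hr]
    simp [hr.ne', hfdef]
  obtain ⟨τbar, hτs, hτeq⟩ := exists_contDiff_extension_of_local h2smooth fun t => by
    have hmemV : ∀ q : ℝ × ℝ, 0 < q.2 → (q.1, (0 : ℝ), q.2) ∈ V := by
      intro q hq
      rw [hV]
      exact ⟨rfl, hq⟩
    have : (𝓝[{q : ℝ × ℝ | 0 < q.2}] (t, (0 : ℝ))).NeBot := by
      rw [show {q : ℝ × ℝ | 0 < q.2} = univ ×ˢ Ioi 0 by ext; simp, nhdsWithin_prod_eq,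
        nhdsWithin_univ]
      infer_instance
    refine exists_smooth_eventuallyEq_of_least_zero (h := fun v => k ((v.1.1, v.2), v.1.2))
      (C := C) hf (hk.continuous.comp (by fun_prop)) nhdsWithin_le_nhds (hsimple t) (hk0 t)
      ?_ ?_ ?_
    · filter_upwards [self_mem_nhdsWithin] with q hq
      refine ((hmem q.1 q.2 0 hq).1 ?_).1
      rw [hflow0]
      exact hmemV q hq
    · filter_upwards [self_mem_nhdsWithin] with q hq
      obtain ⟨⟨⟨hpos, hret⟩, -⟩, hC'⟩ := h2ret _ (hmemV q hq)
      exact ⟨hpos, hC', (hmem q.1 q.2 _ hq).1 hret⟩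
    · filter_upwards [self_mem_nhdsWithin] with q hq σ hσ hfσ hkσ
      exact (h2ret _ (hmemV q hq)).1.2 ⟨hσ, (hmem q.1 q.2 σ hq).2 ⟨hfσ, hkσ⟩⟩
  exact ⟨univ, isOpen_univ, subset_univ _, τbar, hτs.contDiffOn, fun t r hr => hτeq (t, r) hr⟩
end

section
/- Let S² denote the unit sphere in euclidean ℝ³ and let σ denote its standard surface (Lebesgue) measure. Let μ be a finite Borel measure on S² which has no atoms (μ({x}) = 0 for every point x ∈ S²) and which is positive on every nonempty open subset of S². Then μ is topologically conjugate to the properly rescaled Lebesgue measure: there exists a homeomorphism h : S² → S² such that the pushforward measure h_*μ equals (μ(S²)/σ(S²)) · σ. -/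
open MeasureTheory

open Set Filter Topology
open scoped ENNReal

/-- The time-`τ` map of a flow on `ℝ` that moves exactly the points of `(a, b)`. -/
noncomputable def intervalFlow (a b τ x : ℝ) : ℝ :=
  x + max (x - a) 0 * max (b - x) 0 * (Real.exp τ - 1) /
    (max (b - x) 0 + max (x - a) 0 * Real.exp τ)

theorem intervalFlow_of_notMem {a b τ x : ℝ} (hx : x ∉ Ioo a b) : intervalFlow a b τ x = x := by
  have : max (x - a) 0 * max (b - x) 0 = 0 := by
    by_cases h : a < x
    · have : b ≤ x := by
        by_contra h'
        exact hx ⟨h, not_le.1 h'⟩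
      rw [max_eq_right (a := b - x) (by linarith), mul_zero]
    · rw [max_eq_right (a := x - a) (by linarith), zero_mul]
  simp [intervalFlow, this]

theorem intervalFlow_zero (a b x : ℝ) : intervalFlow a b 0 x = x := by
  simp [intervalFlow]

theorem intervalFlow_of_mem {a b τ x : ℝ} (hx : x ∈ Ioo a b) :
    intervalFlow a b τ x =
      (b * (x - a) * Real.exp τ + a * (b - x)) / ((b - x) + (x - a) * Real.exp τ) := by
  obtain ⟨h1, h2⟩ := hx
  have hE := Real.exp_pos τ
  have hden : 0 < (b - x) + (x - a) * Real.exp τ := by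
    have := mul_pos (sub_pos.2 h1) hE
    linarith
  rw [intervalFlow, max_eq_left (a := x - a) (by linarith), max_eq_left (a := b - x) (by linarith),
    eq_div_iff hden.ne', add_mul, div_mul_cancel₀ _ hden.ne']
  ring

theorem intervalFlow_mem {a b τ x : ℝ} (hx : x ∈ Ioo a b) : intervalFlow a b τ x ∈ Ioo a b := by
  rw [intervalFlow_of_mem hx]
  obtain ⟨h1, h2⟩ := hx
  have hE := mul_pos (sub_pos.2 h1) (Real.exp_pos τ)
  have hden : 0 < (b - x) + (x - a) * Real.exp τ := by linarith
  constructor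
  · rw [lt_div_iff₀ hden]
    nlinarith
  · rw [div_lt_iff₀ hden]
    nlinarith

theorem intervalFlow_neg_apply {a b : ℝ} (τ x : ℝ) :
    intervalFlow a b (-τ) (intervalFlow a b τ x) = x := by
  by_cases hx : x ∈ Ioo a b
  · rw [intervalFlow_of_mem (intervalFlow_mem hx), intervalFlow_of_mem hx, Real.exp_neg]
    obtain ⟨h1, h2⟩ := hx
    have hE0 := Real.exp_pos τ
    have hE := mul_pos (sub_pos.2 h1) hE0
    have hden : 0 < (b - x) + (x - a) * Real.exp τ := by linarith
    set E := Real.exp τ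
    set y := (b * (x - a) * E + a * (b - x)) / ((b - x) + (x - a) * E) with hy
    have hya : y - a = (b - a) * (x - a) * E / ((b - x) + (x - a) * E) := by
      rw [hy]; field_simp; ring
    have hby : b - y = (b - a) * (b - x) / ((b - x) + (x - a) * E) := by
      rw [hy]; field_simp; ring
    rw [mul_assoc b, hya, hby]
    have hba : b - a ≠ 0 := by linarith
    field_simp
    ring
  · rw [intervalFlow_of_notMem hx, intervalFlow_of_notMem hx]

theorem continuous_intervalFlow {a b : ℝ} (hab : a < b) :
    Continuous fun p : ℝ × ℝ => intervalFlow a b p.1 p.2 := by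
  unfold intervalFlow
  refine continuous_snd.add (Continuous.div (by fun_prop) (by fun_prop) fun p => ?_)
  have hE := Real.exp_pos p.1
  have hp : 0 ≤ max (p.2 - a) 0 := le_max_right _ _
  have hq : 0 ≤ max (b - p.2) 0 := le_max_right _ _
  rcases lt_or_ge a p.2 with h | h
  · have : 0 < max (p.2 - a) 0 := lt_max_of_lt_left (by linarith)
    positivity
  · have : 0 < max (b - p.2) 0 := lt_max_of_lt_left (by linarith)
    positivity

/-- The parameter at which the flow carries `x` to `e`. -/
noncomputable def hittingTime (a b e x : ℝ) : ℝ :=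
  Real.log ((e - a) * (b - x) / ((b - e) * (x - a)))

theorem intervalFlow_lt_iff {a b e τ x : ℝ} (he : e ∈ Ioo a b) (hx : x ∈ Ioo a b) :
    intervalFlow a b τ x < e ↔ τ < hittingTime a b e x := by
  rw [intervalFlow_of_mem hx, hittingTime]
  obtain ⟨h1, h2⟩ := hx
  obtain ⟨h3, h4⟩ := he
  have hE := mul_pos (sub_pos.2 h1) (Real.exp_pos τ)
  have hden : 0 < (b - x) + (x - a) * Real.exp τ := by linarith
  have hpos : 0 < (b - e) * (x - a) := mul_pos (by linarith) (by linarith)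
  rw [Real.lt_log_iff_exp_lt (div_pos (mul_pos (by linarith) (by linarith)) hpos),
    div_lt_iff₀ hden, lt_div_iff₀ hpos]
  constructor <;> intro h <;> linarith

theorem lt_intervalFlow_iff {a b e τ x : ℝ} (he : e ∈ Ioo a b) (hx : x ∈ Ioo a b) :
    e < intervalFlow a b τ x ↔ hittingTime a b e x < τ := by
  rw [intervalFlow_of_mem hx, hittingTime]
  obtain ⟨h1, h2⟩ := hx
  obtain ⟨h3, h4⟩ := he
  have hE := mul_pos (sub_pos.2 h1) (Real.exp_pos τ)
  have hden : 0 < (b - x) + (x - a) * Real.exp τ := by linarith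
  have hpos : 0 < (b - e) * (x - a) := mul_pos (by linarith) (by linarith)
  rw [Real.log_lt_iff_lt_exp (div_pos (mul_pos (by linarith) (by linarith)) hpos),
    lt_div_iff₀ hden, div_lt_iff₀ hpos]
  constructor <;> intro h <;> linarith

theorem hittingTime_injOn {a b e : ℝ} (he : e ∈ Ioo a b) :
    InjOn (hittingTime a b e) (Ioo a b) := by
  intro x hx y hy hxy
  by_contra hne
  have key : ∀ z ∈ Ioo a b, intervalFlow a b (hittingTime a b e z) z = e := fun z hz =>
    le_antisymm (not_lt.1 fun h => lt_irrefl _ ((lt_intervalFlow_iff he hz).1 h))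
      (not_lt.1 fun h => lt_irrefl _ ((intervalFlow_lt_iff he hz).1 h))
  have h1 := intervalFlow_neg_apply (a := a) (b := b) (hittingTime a b e x) x
  have h2 := intervalFlow_neg_apply (a := a) (b := b) (hittingTime a b e y) y
  rw [key x hx] at h1
  rw [key y hy] at h2
  exact hne (by rw [← h1, ← h2, hxy])

/-- The homeomorphism of the plane which flows each horizontal line for a time depending on
its height. -/
noncomputable def shearFlow {a b : ℝ} (hab : a < b) (T : ℝ → ℝ) (hT : Continuous T) :
    ℝ × ℝ ≃ₜ ℝ × ℝ where
  toFun p := (intervalFlow a b (T p.2) p.1, p.2)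
  invFun p := (intervalFlow a b (-T p.2) p.1, p.2)
  left_inv p := by simp [intervalFlow_neg_apply]
  right_inv p := by
    have := intervalFlow_neg_apply (a := a) (b := b) (-T p.2) p.1
    rw [neg_neg] at this
    simp [this]
  continuous_toFun := by
    have := (continuous_intervalFlow hab).comp
      (show Continuous fun p : ℝ × ℝ => (T p.2, p.1) by fun_prop)
    exact this.prodMk continuous_snd
  continuous_invFun := by
    have := (continuous_intervalFlow hab).comp
      (show Continuous fun p : ℝ × ℝ => (-T p.2, p.1) by fun_prop)
    exact this.prodMk continuous_snd

theorem shearFlow_apply {a b : ℝ} (hab : a < b) (T : ℝ → ℝ) (hT : Continuous T) (p : ℝ × ℝ) :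
    shearFlow hab T hT p = (intervalFlow a b (T p.2) p.1, p.2) := rfl

theorem exists_measure_Iic_eq (ν : Measure ℝ) [IsFiniteMeasure ν] [NullSingletonClass ν] {α : ℝ≥0∞}
    (h0 : 0 < α) (h1 : α < ν univ) : ∃ t, ν (Iic t) = α := by
  have hcont : Continuous fun t => ν.real (Iic t) := by
    have h := intervalIntegral.continuous_primitive (μ := ν) (f := fun _ => (1 : ℝ))
      (fun a b => intervalIntegrable_const) 0
    have h2 : (fun t => ν.real (Iic t)) =
        fun t => (∫ _ in (0 : ℝ)..t, (1 : ℝ) ∂ν) + ν.real (Iic 0) := by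
      funext t
      have := intervalIntegral.integral_Iic_sub_Iic (μ := ν) (f := fun _ => (1 : ℝ))
        (a := 0) (b := t) (integrable_const _) (integrable_const _)
      rw [← this]
      simp
    rw [h2]
    exact h.add continuous_const
  have hα : α ≠ ∞ := (h1.trans_le le_top).ne
  obtain ⟨t1, ht1⟩ : ∃ t, α < ν (Iic t) :=
    ((tendsto_measure_Iic_atTop ν).eventually (lt_mem_nhds h1)).exists
  obtain ⟨t0, ht0⟩ : ∃ t, ν (Iic t) < α := by
    have h : Tendsto (fun n : ℕ => ν (Iic (-(n : ℝ)))) atTop (𝓝 (ν (⋂ n : ℕ, Iic (-(n : ℝ))))) := by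
      refine tendsto_measure_iInter_atTop (fun n => measurableSet_Iic.nullMeasurableSet) ?_
        ⟨0, measure_ne_top _ _⟩
      intro m n hmn
      exact Iic_subset_Iic.2 (by simpa using hmn)
    have h3 : (⋂ n : ℕ, Iic (-(n : ℝ))) = ∅ := by
      ext x
      simp only [mem_iInter, mem_Iic, mem_empty_iff_false, iff_false, not_forall, not_le]
      obtain ⟨n, hn⟩ := exists_nat_gt (-x)
      exact ⟨n, by linarith⟩
    rw [h3, measure_empty] at h
    obtain ⟨n, hn⟩ := (h.eventually (gt_mem_nhds h0)).exists
    exact ⟨_, hn⟩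
  obtain ⟨t, ht⟩ := mem_range_of_exists_le_of_exists_ge (c := α.toReal) hcont
    ⟨t0, (ENNReal.toReal_le_toReal (measure_ne_top _ _) hα).2 ht0.le⟩
    ⟨t1, (ENNReal.toReal_le_toReal hα (measure_ne_top _ _)).2 ht1.le⟩
  exact ⟨t, (ENNReal.toReal_eq_toReal_iff' (measure_ne_top _ _) hα).1 ht⟩

/-- A continuous profile vanishing outside `(c, d)`; for distinct `s` the graphs of multiples of
these profiles meet at most once over `(c, d)`. -/
noncomputable def profile (c d s y : ℝ) : ℝ :=
  max (y - c) 0 * max (d - y) 0 * (1 + s * max (y - c) 0)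

theorem continuous_profile (c d s : ℝ) : Continuous (profile c d s) := by
  unfold profile
  fun_prop

theorem profile_of_notMem {c d s y : ℝ} (hy : y ∉ Ioo c d) : profile c d s y = 0 := by
  have : max (y - c) 0 * max (d - y) 0 = 0 := by
    by_cases h : c < y
    · have : d ≤ y := by
        by_contra h'
        exact hy ⟨h, not_le.1 h'⟩
      rw [max_eq_right (a := d - y) (by linarith), mul_zero]
    · rw [max_eq_right (a := y - c) (by linarith), zero_mul]
  rw [profile, this, zero_mul]

theorem profile_of_mem {c d s y : ℝ} (hy : y ∈ Ioo c d) :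
    profile c d s y = (y - c) * (d - y) * (1 + s * (y - c)) := by
  rw [profile, max_eq_left (by linarith [hy.1]), max_eq_left (by linarith [hy.2])]

theorem profile_pos {c d s y : ℝ} (hs : 0 < s) (hy : y ∈ Ioo c d) : 0 < profile c d s y := by
  rw [profile_of_mem hy]
  have h1 := sub_pos.2 hy.1
  have h2 := sub_pos.2 hy.2
  positivity

/-- The parameter of the curve of the family of profile `s` through `p`. -/
noncomputable def curveParam (a b c d e s : ℝ) (p : ℝ × ℝ) : ℝ :=
  hittingTime a b e p.1 / profile c d s p.2

theorem measurable_curveParam (a b c d e s : ℝ) : Measurable (curveParam a b c d e s) := by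
  unfold curveParam hittingTime
  have := (continuous_profile c d s).measurable
  fun_prop

theorem curveParam_inter_subsingleton {a b c d e s s' t t' : ℝ} (he : e ∈ Ioo a b)
    (hs : 0 < s) (hs' : 0 < s') (ht : t ≠ 0) (hne : (s, t) ≠ (s', t')) :
    ({p | p ∈ Ioo a b ×ˢ Ioo c d ∧ curveParam a b c d e s p = t} ∩
      {p | p ∈ Ioo a b ×ˢ Ioo c d ∧ curveParam a b c d e s' p = t'}).Subsingleton := by
  have key : ∀ p : ℝ × ℝ, p ∈ Ioo a b ×ˢ Ioo c d → curveParam a b c d e s p = t →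
      curveParam a b c d e s' p = t' →
      hittingTime a b e p.1 = t * profile c d s p.2 ∧
        t * (1 + s * (p.2 - c)) = t' * (1 + s' * (p.2 - c)) := by
    rintro p ⟨-, hp2⟩ h1 h2
    have hw := profile_pos hs hp2
    have hw' := profile_pos hs' hp2
    rw [curveParam, div_eq_iff hw.ne'] at h1
    rw [curveParam, div_eq_iff hw'.ne'] at h2
    refine ⟨h1, ?_⟩
    rw [h1, profile_of_mem hp2, profile_of_mem hp2] at h2
    have hpos : (p.2 - c) * (d - p.2) ≠ 0 :=
      (mul_pos (sub_pos.2 hp2.1) (sub_pos.2 hp2.2)).ne'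
    apply mul_left_cancel₀ hpos
    linarith
  rintro p ⟨⟨hp, h1⟩, -, h2⟩ q ⟨⟨hq, h3⟩, -, h4⟩
  obtain ⟨hp1, hp2⟩ := key p hp h1 h2
  obtain ⟨hq1, hq2⟩ := key q hq h3 h4
  have hy : p.2 = q.2 := by
    by_contra hne'
    have h5 : (t * s - t' * s') * (p.2 - q.2) = 0 := by linarith
    have h6 : t * s = t' * s' := by
      rcases mul_eq_zero.1 h5 with h | h
      · linarith
      · exact absurd (sub_eq_zero.1 h) hne'
    have h7 : t = t' := by
      have : t * 1 + (t * s) * (p.2 - c) = t' * 1 + (t' * s') * (p.2 - c) := by linarith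
      rw [h6] at this
      linarith
    subst h7
    exact hne (by rw [mul_left_cancel₀ ht h6])
  refine Prod.ext ?_ hy
  apply hittingTime_injOn he hp.1 hq.1
  rw [hp1, hq1, hy]

/-- For a diffuse measure, some family of profile `s` consists of null curves only. -/
theorem exists_curveParam_null {a b c d e : ℝ} (he : e ∈ Ioo a b) (m : Measure (ℝ × ℝ))
    [IsFiniteMeasure m] [NullSingletonClass m] (hline : m {p | p.1 = e} = 0) :
    ∃ s, 0 < s ∧ ∀ t, m {p | p ∈ Ioo a b ×ˢ Ioo c d ∧ curveParam a b c d e s p = t} = 0 := by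
  set A : {q : ℝ × ℝ // 0 < q.1 ∧ q.2 ≠ 0} → Set (ℝ × ℝ) :=
    fun q => {p | p ∈ Ioo a b ×ˢ Ioo c d ∧ curveParam a b c d e q.1.1 p = q.1.2} with hA
  have hrect : MeasurableSet (Ioo a b ×ˢ Ioo c d : Set (ℝ × ℝ)) :=
    measurableSet_Ioo.prod measurableSet_Ioo
  have hcount := Measure.countable_meas_pos_of_disjoint_iUnion₀ (μ := m) (As := A)
    (fun q => (hrect.inter
      (measurable_curveParam a b c d e q.1.1 (measurableSet_singleton q.1.2))).nullMeasurableSet)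
    (fun q q' hqq => ((curveParam_inter_subsingleton he q.2.1 q'.2.1 q.2.2
      (fun h => hqq (Subtype.ext h))).measure_zero m))
  have hcount' := hcount.image fun q => q.1.1
  obtain ⟨s, hs, hs0, -⟩ := (hcount'.dense_compl ℝ).exists_between (show (0 : ℝ) < 1 by norm_num)
  refine ⟨s, hs0, fun t => ?_⟩
  by_cases ht : t = 0
  · refine measure_mono_null ?_ hline
    rintro p ⟨hp, hpt⟩
    rw [ht, curveParam, div_eq_zero_iff, or_iff_left (profile_pos hs0 hp.2).ne'] at hpt
    have h1 := intervalFlow_zero a b p.1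
    have h2 := mt (intervalFlow_lt_iff (τ := 0) he hp.1).1 (by rw [hpt]; exact lt_irrefl _)
    have h3 := mt (lt_intervalFlow_iff (τ := 0) he hp.1).1 (by rw [hpt]; exact lt_irrefl _)
    rw [h1] at h2 h3
    exact le_antisymm (not_lt.1 h3) (not_lt.1 h2)
  · by_contra hpos
    exact hs ⟨⟨(s, t), hs0, ht⟩, pos_iff_ne_zero.2 hpos, rfl⟩

theorem exists_bisect {a b c d e : ℝ} (he : e ∈ Ioo a b) (m : Measure (ℝ × ℝ))
    [IsFiniteMeasure m] [NullSingletonClass m] (hline : m {p | p.1 = e} = 0) {α : ℝ≥0∞}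
    (h0 : 0 < α) (h1 : α < m (Ioo a b ×ˢ Ioo c d)) :
    ∃ v : ℝ × ℝ ≃ₜ ℝ × ℝ, (∀ p, p ∉ Ioo a b ×ˢ Ioo c d → v p = p) ∧
      m (v ⁻¹' (Ioo a e ×ˢ Ioo c d)) = α ∧
      m (v ⁻¹' (Ioo a e ×ˢ Ioo c d)) + m (v ⁻¹' (Ioo e b ×ˢ Ioo c d)) =
        m (Ioo a b ×ˢ Ioo c d) := by
  obtain ⟨s, hs, hnull⟩ := exists_curveParam_null (c := c) (d := d) he m hline
  have hab : a < b := he.1.trans he.2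
  set D : Set (ℝ × ℝ) := Ioo a b ×ˢ Ioo c d with hD
  have hmeas := measurable_curveParam a b c d e s
  set ν : Measure ℝ := (m.restrict D).map (curveParam a b c d e s) with hν
  have hνap : ∀ S, MeasurableSet S → ν S = m {p | p ∈ D ∧ curveParam a b c d e s p ∈ S} := by
    intro S hS
    rw [hν, Measure.map_apply hmeas hS, Measure.restrict_apply (hmeas hS), inter_comm]
    rfl
  have : NullSingletonClass ν := ⟨fun t => by
    rw [hνap _ (measurableSet_singleton t)]
    exact hnull t⟩
  have hνu : ν univ = m D := by
    rw [hνap _ MeasurableSet.univ]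
    simp
  obtain ⟨t, ht⟩ := exists_measure_Iic_eq ν (α := m D - α) (tsub_pos_of_lt h1)
    (by rw [hνu]; exact ENNReal.sub_lt_self (measure_ne_top _ _) (h0.trans h1).ne' h0.ne')
  have htIoi : ν (Iic t) + ν (Ioi t) = m D := by
    rw [← hνu, ← compl_Iic, measure_add_measure_compl measurableSet_Iic]
  refine ⟨(shearFlow hab (fun y => t * profile c d s y)
    ((continuous_profile c d s).const_mul t)), ?_⟩
  have hid : ∀ p, p ∉ D → shearFlow hab (fun y => t * profile c d s y)
      ((continuous_profile c d s).const_mul t) p = p := by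
    intro p hp
    rw [shearFlow_apply]
    refine Prod.ext ?_ rfl
    by_cases hx : p.1 ∈ Ioo a b
    · have hy : p.2 ∉ Ioo c d := fun hy => hp ⟨hx, hy⟩
      simp only [profile_of_notMem hy, mul_zero, intervalFlow_zero]
    · exact intervalFlow_of_notMem hx
  have hleft : (shearFlow hab (fun y => t * profile c d s y)
      ((continuous_profile c d s).const_mul t)) ⁻¹' (Ioo a e ×ˢ Ioo c d) =
      {p | p ∈ D ∧ curveParam a b c d e s p ∈ Ioi t} := by
    ext p
    by_cases hp : p ∈ D
    · simp only [mem_preimage, shearFlow_apply, mem_prod, mem_ofPred_eq, hp, true_and, mem_Ioi,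
        mem_Ioo, hp.2.1, hp.2.2, and_true, (intervalFlow_mem hp.1).1]
      rw [intervalFlow_lt_iff he hp.1, curveParam, lt_div_iff₀ (profile_pos hs hp.2)]
    · rw [mem_preimage, hid p hp]
      simp only [mem_ofPred_eq, hp, false_and, iff_false]
      exact fun h => hp ⟨⟨h.1.1, h.1.2.trans he.2⟩, h.2⟩
  have hright : (shearFlow hab (fun y => t * profile c d s y)
      ((continuous_profile c d s).const_mul t)) ⁻¹' (Ioo e b ×ˢ Ioo c d) =
      {p | p ∈ D ∧ curveParam a b c d e s p ∈ Iio t} := by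
    ext p
    by_cases hp : p ∈ D
    · simp only [mem_preimage, shearFlow_apply, mem_prod, mem_ofPred_eq, hp, true_and, mem_Iio,
        mem_Ioo, hp.2.1, hp.2.2, and_true, (intervalFlow_mem hp.1).2]
      rw [lt_intervalFlow_iff he hp.1, curveParam, div_lt_iff₀ (profile_pos hs hp.2)]
    · rw [mem_preimage, hid p hp]
      simp only [mem_ofPred_eq, hp, false_and, iff_false]
      exact fun h => hp ⟨⟨he.1.trans h.1.1, h.1.2⟩, h.2⟩
  refine ⟨hid, ?_, ?_⟩
  · rw [hleft, ← hνap _ measurableSet_Ioi]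
    rw [ht] at htIoi
    have hαm : m D - α + α = m D := tsub_add_cancel_of_le h1.le
    exact (ENNReal.add_right_inj (ENNReal.sub_ne_top (measure_ne_top _ _))).1
      (htIoi.trans hαm.symm)
  · rw [hleft, hright, ← hνap _ measurableSet_Ioi, ← hνap _ measurableSet_Iio,
      measure_congr Iio_ae_eq_Iic, add_comm, htIoi]

/-- `E` is a nonempty open rectangle with sides parallel to the axes. -/
def IsOpenRect (E : Set (ℝ × ℝ)) : Prop :=
  ∃ a b c d : ℝ, a < b ∧ c < d ∧ E = Ioo a b ×ˢ Ioo c d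

theorem IsOpenRect.isOpen {E : Set (ℝ × ℝ)} (h : IsOpenRect E) : IsOpen E := by
  obtain ⟨a, b, c, d, -, -, rfl⟩ := h
  exact isOpen_Ioo.prod isOpen_Ioo

/-- `m` charges every nonempty open subset of `A`. -/
def PositiveOn (m : Measure (ℝ × ℝ)) (A : Set (ℝ × ℝ)) : Prop :=
  ∀ U, IsOpen U → U ⊆ A → U.Nonempty → 0 < m U

theorem PositiveOn.mono {m : Measure (ℝ × ℝ)} {A B : Set (ℝ × ℝ)} (h : PositiveOn m B)
    (hAB : A ⊆ B) : PositiveOn m A := fun U hU hUA hne => h U hU (hUA.trans hAB) hne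

/-- `u` only moves points inside the members of `𝒟`. -/
def MovesWithin (u : ℝ × ℝ ≃ₜ ℝ × ℝ) (𝒟 : Set (Set (ℝ × ℝ))) : Prop :=
  ∀ x, u x = x ∨ ∃ D ∈ 𝒟, x ∈ D ∧ u x ∈ D

theorem MovesWithin.mem_iff {u : ℝ × ℝ ≃ₜ ℝ × ℝ} {𝒟 : Set (Set (ℝ × ℝ))} (h : MovesWithin u 𝒟)
    {A : Set (ℝ × ℝ)} (hA : ⋃₀ 𝒟 ⊆ A) {x : ℝ × ℝ} : u x ∈ A ↔ x ∈ A := by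
  rcases h x with h | ⟨D, hD, h1, h2⟩
  · rw [h]
  · exact iff_of_true (hA ⟨D, hD, h2⟩) (hA ⟨D, hD, h1⟩)

theorem MovesWithin.eq_of_notMem {u : ℝ × ℝ ≃ₜ ℝ × ℝ} {𝒟 : Set (Set (ℝ × ℝ))}
    (h : MovesWithin u 𝒟) {x : ℝ × ℝ} (hx : x ∉ ⋃₀ 𝒟) : u x = x :=
  (h x).resolve_right fun ⟨D, hD, h1, _⟩ => hx ⟨D, hD, h1⟩

theorem movesWithin_singleton {u : ℝ × ℝ ≃ₜ ℝ × ℝ} {D : Set (ℝ × ℝ)} (h : ∀ x, x ∉ D → u x = x) :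
    MovesWithin u {D} := by
  intro x
  by_cases hx : u x = x
  · exact Or.inl hx
  · refine Or.inr ⟨D, rfl, by_contra fun h' => hx (h x h'), by_contra fun h' => hx ?_⟩
    exact u.injective (h (u x) h')

theorem PositiveOn.map {m : Measure (ℝ × ℝ)} {A : Set (ℝ × ℝ)} (h : PositiveOn m A)
    (u : ℝ × ℝ ≃ₜ ℝ × ℝ) (hu : ∀ x, u x ∈ A → x ∈ A) : PositiveOn (m.map u) A := by
  intro U hU hUA hne
  rw [u.measurableEmbedding.map_apply]
  exact h _ (hU.preimage u.continuous) (fun x hx => hu x (hUA hx))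
    (hne.preimage u.surjective)

theorem nullSingletonClass_map {m : Measure (ℝ × ℝ)} [NullSingletonClass m]
    (u : ℝ × ℝ ≃ₜ ℝ × ℝ) : NullSingletonClass (m.map u) := ⟨fun x => by
  rw [u.measurableEmbedding.map_apply]
  exact (subsingleton_singleton.preimage u.injective).measure_zero m⟩

/-- Some homeomorphism moving points only within the members of `𝒟` makes the image of `m` agree
with `m'` on a partition of `⋃₀ 𝒟` (up to a null set) into open rectangles of diameter at most
`ε`. -/
def Refinable (ε : ℝ) (m m' : Measure (ℝ × ℝ)) (𝒟 : Set (Set (ℝ × ℝ))) : Prop :=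
  ∃ u : ℝ × ℝ ≃ₜ ℝ × ℝ, MovesWithin u 𝒟 ∧
    ∃ 𝒞 : Set (Set (ℝ × ℝ)), 𝒞.Finite ∧ 𝒞.PairwiseDisjoint id ∧
      (∀ E ∈ 𝒞, IsOpenRect E ∧ E ⊆ ⋃₀ 𝒟 ∧ (∀ x ∈ E, ∀ y ∈ E, dist x y ≤ ε) ∧
        m (u ⁻¹' E) = m' E) ∧
      m' (⋃₀ 𝒟 \ ⋃₀ 𝒞) = 0

theorem refinable_empty (ε : ℝ) (m m' : Measure (ℝ × ℝ)) : Refinable ε m m' ∅ :=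
  ⟨Homeomorph.refl _, fun _ => Or.inl rfl, ∅, finite_empty, pairwiseDisjoint_empty, by simp,
    by simp⟩

theorem Refinable.union {ε : ℝ} {m m' : Measure (ℝ × ℝ)} {𝒟₁ 𝒟₂ : Set (Set (ℝ × ℝ))}
    (h₁ : Refinable ε m m' 𝒟₁) (h₂ : Refinable ε m m' 𝒟₂) (hd : Disjoint (⋃₀ 𝒟₁) (⋃₀ 𝒟₂)) :
    Refinable ε m m' (𝒟₁ ∪ 𝒟₂) := by
  obtain ⟨u₁, hu₁, 𝒞₁, hf₁, hp₁, hE₁, hn₁⟩ := h₁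
  obtain ⟨u₂, hu₂, 𝒞₂, hf₂, hp₂, hE₂, hn₂⟩ := h₂
  have hfix₁ : ∀ x ∈ ⋃₀ 𝒟₂, u₁ x = x := fun x hx =>
    hu₁.eq_of_notMem fun h => hd.le_bot ⟨h, hx⟩
  have hfix₂ : ∀ x ∈ ⋃₀ 𝒟₁, u₂ x = x := fun x hx =>
    hu₂.eq_of_notMem fun h => hd.le_bot ⟨hx, h⟩
  refine ⟨u₂.trans u₁, fun x => ?_, 𝒞₁ ∪ 𝒞₂, hf₁.union hf₂, ?_, ?_, ?_⟩
  · rw [Homeomorph.trans_apply]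
    rcases hu₂ x with h | ⟨D, hD, h1, h2⟩
    · rw [h]
      rcases hu₁ x with h' | ⟨D, hD, h1, h2⟩
      · exact Or.inl h'
      · exact Or.inr ⟨D, Or.inl hD, h1, h2⟩
    · rw [hfix₁ _ ⟨D, hD, h2⟩]
      exact Or.inr ⟨D, Or.inr hD, h1, h2⟩
  · rw [pairwiseDisjoint_union]
    exact ⟨hp₁, hp₂, fun E hE F hF _ => hd.mono (hE₁ E hE).2.1 (hE₂ F hF).2.1⟩
  · rintro E (hE | hE)
    · obtain ⟨h1, h2, h3, h4⟩ := hE₁ E hE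
      refine ⟨h1, h2.trans (sUnion_subset_sUnion subset_union_left), h3, ?_⟩
      rw [← h4]
      congr 1
      ext x
      simp only [mem_preimage, Homeomorph.trans_apply]
      by_cases hx : x ∈ ⋃₀ 𝒟₁
      · rw [hfix₂ x hx]
      · refine iff_of_false (fun h => ?_) (fun h => hx ((hu₁.mem_iff le_rfl).1 (h2 h)))
        have h5 : u₂ x ∈ ⋃₀ 𝒟₁ := (hu₁.mem_iff le_rfl).1 (h2 h)
        have h6 : u₂ x = x := u₂.injective (hfix₂ _ h5)
        exact hx (h6 ▸ h5)
    · obtain ⟨h1, h2, h3, h4⟩ := hE₂ E hE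
      refine ⟨h1, h2.trans (sUnion_subset_sUnion subset_union_right), h3, ?_⟩
      rw [← h4]
      congr 1
      ext x
      simp only [mem_preimage, Homeomorph.trans_apply]
      by_cases hx : u₂ x ∈ ⋃₀ 𝒟₂
      · rw [hfix₁ _ hx]
      · refine iff_of_false (fun h => ?_) (fun h => hx (h2 h))
        have h6 : u₁ (u₂ x) = u₂ x := u₁.injective (hfix₁ _ (h2 h))
        exact hx (h6 ▸ h2 h)
  · refine measure_mono_null ?_ (measure_union_null hn₁ hn₂)
    rw [sUnion_union, sUnion_union]
    rintro x ⟨hx | hx, hx'⟩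
    · exact Or.inl ⟨hx, fun h => hx' (Or.inl h)⟩
    · exact Or.inr ⟨hx, fun h => hx' (Or.inr h)⟩

theorem Refinable.of_map {ε : ℝ} {m m' : Measure (ℝ × ℝ)} {D : Set (ℝ × ℝ)}
    {𝒟 : Set (Set (ℝ × ℝ))} {v : ℝ × ℝ ≃ₜ ℝ × ℝ} (hv : ∀ x, x ∉ D → v x = x)
    (h𝒟 : ⋃₀ 𝒟 ⊆ D) (hnull : m' (D \ ⋃₀ 𝒟) = 0) (h : Refinable ε (m.map v) m' 𝒟) :
    Refinable ε m m' {D} := by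
  obtain ⟨u, hu, 𝒞, hf, hp, hE, hn⟩ := h
  refine ⟨v.trans u, movesWithin_singleton fun x hx => ?_, 𝒞, hf, hp, fun E hE' => ?_, ?_⟩
  · rw [Homeomorph.trans_apply, hv x hx]
    exact hu.eq_of_notMem fun h => hx (h𝒟 h)
  · obtain ⟨h1, h2, h3, h4⟩ := hE E hE'
    refine ⟨h1, by rw [sUnion_singleton]; exact h2.trans h𝒟, h3, ?_⟩
    rw [← h4, v.measurableEmbedding.map_apply]
    rfl
  · rw [sUnion_singleton]
    refine measure_mono_null (fun x hx => ?_) (measure_union_null hnull hn)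
    by_cases hx' : x ∈ ⋃₀ 𝒟
    · exact Or.inr ⟨hx', hx.2⟩
    · exact Or.inl ⟨hx.1, hx'⟩

/-- The rectangle `(a, b) × (c, d)` is refinable for all diffuse fully supported measures of equal
mass. -/
def RectRefinable (ε a b c d : ℝ) : Prop :=
  ∀ (m m' : Measure (ℝ × ℝ)) [IsFiniteMeasure m] [IsFiniteMeasure m'] [NullSingletonClass m]
    [NullSingletonClass m'], PositiveOn m (Ioo a b ×ˢ Ioo c d) →
    PositiveOn m' (Ioo a b ×ˢ Ioo c d) → m (Ioo a b ×ˢ Ioo c d) = m' (Ioo a b ×ˢ Ioo c d) →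
    Refinable ε m m' {Ioo a b ×ˢ Ioo c d}

theorem rectRefinable_of_le {ε a b c d : ℝ} (hab : a < b) (hcd : c < d) (h1 : b - a ≤ ε)
    (h2 : d - c ≤ ε) : RectRefinable ε a b c d := by
  intro m m' _ _ _ _ _ _ heq
  refine ⟨Homeomorph.refl _, fun _ => Or.inl rfl, {Ioo a b ×ˢ Ioo c d}, finite_singleton _,
    pairwiseDisjoint_singleton _ _, ?_, by simp⟩
  rintro E rfl
  refine ⟨⟨a, b, c, d, hab, hcd, rfl⟩, by simp, ?_, heq⟩
  rintro x ⟨hx1, hx2⟩ y ⟨hy1, hy2⟩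
  rw [Prod.dist_eq, max_le_iff, Real.dist_eq, Real.dist_eq]
  constructor <;> rw [abs_le] <;> constructor <;>
    linarith [hx1.1, hx1.2, hx2.1, hx2.2, hy1.1, hy1.2, hy2.1, hy2.2]

theorem RectRefinable.swap {ε a b c d : ℝ} (h : RectRefinable ε c d a b) :
    RectRefinable ε a b c d := by
  intro m m' _ _ _ _ hm hm' heq
  let σ : ℝ × ℝ ≃ₜ ℝ × ℝ := Homeomorph.prodComm ℝ ℝ
  have hσ : ∀ a b c d : ℝ, σ ⁻¹' (Ioo a b ×ˢ Ioo c d) = Ioo c d ×ˢ Ioo a b := fun a b c d =>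
    preimage_swap_prod _ _
  have := nullSingletonClass_map (m := m) σ
  have := nullSingletonClass_map (m := m') σ
  have hpos : ∀ {n : Measure (ℝ × ℝ)}, PositiveOn n (Ioo a b ×ˢ Ioo c d) →
      PositiveOn (n.map σ) (Ioo c d ×ˢ Ioo a b) := by
    intro n hn U hU hUA hne
    rw [σ.measurableEmbedding.map_apply]
    refine hn _ (hU.preimage σ.continuous) ?_ (hne.preimage σ.surjective)
    rw [← hσ]
    exact preimage_mono hUA
  obtain ⟨u, hu, 𝒞, hf, hp, hE, hn⟩ := h (m.map σ) (m'.map σ) (hpos hm) (hpos hm') (by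
    rw [σ.measurableEmbedding.map_apply, σ.measurableEmbedding.map_apply, hσ, heq])
  rw [sUnion_singleton] at hE hn
  refine ⟨(σ.trans u).trans σ, movesWithin_singleton fun x hx => ?_,
    (fun E => σ ⁻¹' E) '' 𝒞, hf.image _, ?_, ?_, ?_⟩
  · have : u (σ x) = σ x := by
      apply hu.eq_of_notMem
      rw [sUnion_singleton, ← mem_preimage, hσ]
      exact hx
    rw [Homeomorph.trans_apply, Homeomorph.trans_apply, this]
    rfl
  · rintro _ ⟨E, hE, rfl⟩ _ ⟨F, hF, rfl⟩ hne
    exact (hp hE hF fun h => hne (by rw [h])).preimage σ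
  · rintro _ ⟨E, hE', rfl⟩
    obtain ⟨⟨a', b', c', d', hab', hcd', rfl⟩, h2, h3, h4⟩ := hE E hE'
    refine ⟨⟨c', d', a', b', hcd', hab', hσ _ _ _ _⟩, ?_, ?_, ?_⟩
    · rw [sUnion_singleton, ← hσ c d a b]
      exact preimage_mono h2
    · intro x hx y hy
      have := h3 _ hx _ hy
      rw [Prod.dist_eq, max_comm] at this
      exact this
    · rw [σ.measurableEmbedding.map_apply, σ.measurableEmbedding.map_apply] at h4
      rw [← h4]
      rfl
  · rw [sUnion_singleton, ← hσ]
    rw [σ.measurableEmbedding.map_apply] at hn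
    refine measure_mono_null ?_ hn
    rintro x ⟨hx, hx'⟩
    refine ⟨hx, fun ⟨E, hE, h⟩ => hx' ⟨_, ⟨E, hE, rfl⟩, h⟩⟩

theorem RectRefinable.of_bisect {ε a b c d : ℝ} (hab : a < b) (hcd : c < d)
    (H : ∀ e ∈ Ioo (a + (b - a) / 3) (b - (b - a) / 3),
      RectRefinable ε a e c d ∧ RectRefinable ε e b c d) : RectRefinable ε a b c d := by
  intro m m' _ _ _ _ hm hm' heq
  have hc1 := Measure.countable_meas_level_set_pos (μ := m) measurable_fst
  have hc2 := Measure.countable_meas_level_set_pos (μ := m') measurable_fst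
  obtain ⟨e, hes, he1, he2⟩ := ((hc1.union hc2).dense_compl ℝ).exists_between
    (show a + (b - a) / 3 < b - (b - a) / 3 by linarith)
  have he : e ∈ Ioo a b := ⟨by linarith, by linarith⟩
  rw [mem_compl_iff, mem_union, not_or] at hes
  have hl1 : m {p | p.1 = e} = 0 := by_contra fun h => hes.1 (pos_iff_ne_zero.2 h)
  have hl2 : m' {p | p.1 = e} = 0 := by_contra fun h => hes.2 (pos_iff_ne_zero.2 h)
  have hsub1 : (Ioo a e ×ˢ Ioo c d : Set (ℝ × ℝ)) ⊆ Ioo a b ×ˢ Ioo c d :=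
    prod_mono (Ioo_subset_Ioo_right he.2.le) le_rfl
  have hsub2 : (Ioo e b ×ˢ Ioo c d : Set (ℝ × ℝ)) ⊆ Ioo a b ×ˢ Ioo c d :=
    prod_mono (Ioo_subset_Ioo_left he.1.le) le_rfl
  have hdisj : Disjoint (Ioo a e ×ˢ Ioo c d : Set (ℝ × ℝ)) (Ioo e b ×ˢ Ioo c d) := by
    rw [disjoint_left]
    rintro x ⟨h1, -⟩ ⟨h2, -⟩
    exact lt_asymm h1.2 h2.1
  have hnull : m' ((Ioo a b ×ˢ Ioo c d) \ (Ioo a e ×ˢ Ioo c d ∪ Ioo e b ×ˢ Ioo c d)) = 0 := by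
    refine measure_mono_null ?_ hl2
    rintro x ⟨⟨h1, h2⟩, h3⟩
    rcases lt_trichotomy x.1 e with h | h | h
    · exact absurd (Or.inl ⟨⟨h1.1, h⟩, h2⟩) h3
    · exact h
    · exact absurd (Or.inr ⟨⟨h, h1.2⟩, h2⟩) h3
  have hm2 : MeasurableSet (Ioo e b ×ˢ Ioo c d : Set (ℝ × ℝ)) :=
    measurableSet_Ioo.prod measurableSet_Ioo
  have hsum : m' (Ioo a e ×ˢ Ioo c d) + m' (Ioo e b ×ˢ Ioo c d) = m' (Ioo a b ×ˢ Ioo c d) := by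
    rw [← measure_union hdisj hm2]
    refine le_antisymm (measure_mono (union_subset hsub1 hsub2)) ?_
    rw [← add_zero (m' (_ ∪ _)), ← hnull]
    refine (measure_mono fun x hx => ?_).trans (measure_union_le _ _)
    exact or_iff_not_imp_left.2 fun h => ⟨hx, h⟩
  have hp1 : 0 < m' (Ioo a e ×ˢ Ioo c d) := hm' _ (isOpen_Ioo.prod isOpen_Ioo) hsub1
    ((nonempty_Ioo.2 he.1).prod (nonempty_Ioo.2 hcd))
  have hp2 : 0 < m' (Ioo e b ×ˢ Ioo c d) := hm' _ (isOpen_Ioo.prod isOpen_Ioo) hsub2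
    ((nonempty_Ioo.2 he.2).prod (nonempty_Ioo.2 hcd))
  obtain ⟨v, hv, hv1, hv2⟩ := exists_bisect (c := c) (d := d) he m hl1 hp1 (by
    rw [heq, ← hsum]
    exact ENNReal.lt_add_right (measure_ne_top _ _) hp2.ne')
  rw [hv1, heq, ← hsum] at hv2
  have hv2' := (ENNReal.add_right_inj (measure_ne_top _ _)).1 hv2
  have := nullSingletonClass_map (m := m) v
  have hpos : PositiveOn (m.map v) (Ioo a b ×ˢ Ioo c d) := hm.map v fun x hx =>
    ((movesWithin_singleton hv).mem_iff (by rw [sUnion_singleton])).1 hx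
  refine Refinable.of_map (𝒟 := {Ioo a e ×ˢ Ioo c d} ∪ {Ioo e b ×ˢ Ioo c d}) hv ?_ ?_ ?_
  · rw [sUnion_union, sUnion_singleton, sUnion_singleton]
    exact union_subset hsub1 hsub2
  · rw [sUnion_union, sUnion_singleton, sUnion_singleton]
    exact hnull
  · refine Refinable.union ((H e ⟨he1, he2⟩).1 _ _ (hpos.mono hsub1) (hm'.mono hsub1) ?_)
      ((H e ⟨he1, he2⟩).2 _ _ (hpos.mono hsub2) (hm'.mono hsub2) ?_) ?_
    · rw [v.measurableEmbedding.map_apply, hv1]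
    · rw [v.measurableEmbedding.map_apply, hv2']
    · rwa [sUnion_singleton, sUnion_singleton]

theorem rectRefinable {ε a b c d : ℝ} (hε : 0 < ε) (hab : a < b) (hcd : c < d) :
    RectRefinable ε a b c d := by
  have hpow : ∀ n : ℕ, ∀ x y z : ℝ, x - y ≤ (3 / 2 : ℝ) ^ (n + 1) * ε → z ≤ 2 / 3 * (x - y) →
      z ≤ (3 / 2 : ℝ) ^ n * ε := by
    intro n x y z h1 h2
    rw [pow_succ] at h1
    linarith
  have width : ∀ n : ℕ, ∀ a b c d : ℝ, a < b → c < d → b - a ≤ (3 / 2 : ℝ) ^ n * ε →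
      d - c ≤ ε → RectRefinable ε a b c d := by
    intro n
    induction n with
    | zero =>
      intro a b c d hab hcd h1 h2
      exact rectRefinable_of_le hab hcd (by simpa using h1) h2
    | succ n ih =>
      intro a b c d hab hcd h1 h2
      refine RectRefinable.of_bisect hab hcd fun e he => ?_
      exact ⟨ih a e c d (by linarith [he.1]) hcd (hpow n b a _ h1 (by linarith [he.2])) h2,
        ih e b c d (by linarith [he.2]) hcd (hpow n b a _ h1 (by linarith [he.1])) h2⟩
  have hex : ∀ x : ℝ, ∃ n : ℕ, x ≤ (3 / 2 : ℝ) ^ n * ε := by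
    intro x
    obtain ⟨n, hn⟩ := pow_unbounded_of_one_lt (x / ε) (show (1 : ℝ) < 3 / 2 by norm_num)
    exact ⟨n, ((div_lt_iff₀ hε).1 hn).le⟩
  have height : ∀ n : ℕ, ∀ a b c d : ℝ, a < b → c < d → d - c ≤ (3 / 2 : ℝ) ^ n * ε →
      RectRefinable ε a b c d := by
    intro n
    induction n with
    | zero =>
      intro a b c d hab hcd h1
      obtain ⟨k, hk⟩ := hex (b - a)
      exact width k a b c d hab hcd hk (by simpa using h1)
    | succ n ih =>
      intro a b c d hab hcd h1
      refine RectRefinable.swap (RectRefinable.of_bisect hcd hab fun e he => ?_)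
      exact ⟨(ih a b c e hab (by linarith [he.1]) (hpow n d c _ h1 (by linarith [he.2]))).swap,
        (ih a b e d hab (by linarith [he.2]) (hpow n d c _ h1 (by linarith [he.1]))).swap⟩
  obtain ⟨n, hn⟩ := hex (d - c)
  exact height n a b c d hab hcd hn

theorem refinable_of_finite {ε : ℝ} (hε : 0 < ε) (m m' : Measure (ℝ × ℝ)) [IsFiniteMeasure m]
    [IsFiniteMeasure m'] [NullSingletonClass m] [NullSingletonClass m']
    {𝒟 : Set (Set (ℝ × ℝ))} (hf : 𝒟.Finite) (hd : 𝒟.PairwiseDisjoint id)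
    (h : ∀ D ∈ 𝒟, IsOpenRect D ∧ PositiveOn m D ∧ PositiveOn m' D ∧ m D = m' D) :
    Refinable ε m m' 𝒟 := by
  induction 𝒟, hf using Set.Finite.induction_on with
  | empty => exact refinable_empty ε m m'
  | @insert D 𝒟 hD _ ih =>
    rw [insert_eq]
    refine Refinable.union ?_ (ih (hd.subset (subset_insert _ _))
      fun E hE => h E (mem_insert_of_mem _ hE)) ?_
    · obtain ⟨⟨a, b, c, d, hab, hcd, rfl⟩, h1, h2, h3⟩ := h D (mem_insert _ _)
      exact rectRefinable hε hab hcd m m' h1 h2 h3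
    · rw [sUnion_singleton, disjoint_sUnion_right]
      intro E hE
      exact hd (mem_insert _ _) (mem_insert_of_mem _ hE) fun h => hD (h ▸ hE)

/-- A uniformly fast convergent sequence of homeomorphisms whose inverses also converge uniformly
fast has a homeomorphism as its limit. -/
theorem exists_homeomorph_limit {X : Type*} [MetricSpace X] [CompleteSpace X] (C : ℝ)
    (f : ℕ → X ≃ₜ X)
    (h1 : ∀ n x, dist (f n x) (f (n + 1) x) ≤ C / 2 / 2 ^ n)
    (h2 : ∀ n x, dist ((f n).symm x) ((f (n + 1)).symm x) ≤ C / 2 / 2 ^ n) :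
    ∃ F : X ≃ₜ X, ∀ n x, dist (f n x) (F x) ≤ C / 2 ^ n := by
  have lim : ∀ g : ℕ → X ≃ₜ X, (∀ n x, dist (g n x) (g (n + 1) x) ≤ C / 2 / 2 ^ n) →
      ∃ G : X → X, Continuous G ∧ ∀ n x, dist (g n x) (G x) ≤ C / 2 ^ n := by
    intro g hg
    have hlim : ∀ x, ∃ y, Tendsto (fun n => g n x) atTop (𝓝 y) := fun x =>
      cauchySeq_tendsto_of_complete (cauchySeq_of_le_geometric_two fun n => hg n x)
    choose G hG using hlim
    have hdist : ∀ n x, dist (g n x) (G x) ≤ C / 2 ^ n := fun n x =>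
      dist_le_of_le_geometric_two_of_tendsto (fun n => hg n x) (hG x) n
    refine ⟨G, ?_, hdist⟩
    have hu : TendstoUniformly (fun n => (g n : X → X)) G atTop := by
      rw [Metric.tendstoUniformly_iff]
      intro ε hε
      have ht : Tendsto (fun n : ℕ => C / (2 : ℝ) ^ n) atTop (𝓝 0) :=
        tendsto_const_nhds.div_atTop (tendsto_pow_atTop_atTop_of_one_lt one_lt_two)
      filter_upwards [ht.eventually (gt_mem_nhds hε)] with n hn x
      rw [dist_comm]
      exact (hdist n x).trans_lt hn
    exact hu.continuous (Frequently.of_forall fun n => (g n).continuous)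
  have ht : Tendsto (fun n : ℕ => C / (2 : ℝ) ^ n) atTop (𝓝 0) :=
    tendsto_const_nhds.div_atTop (tendsto_pow_atTop_atTop_of_one_lt one_lt_two)
  have inv : ∀ (g : ℕ → X ≃ₜ X) (G G' : X → X), Continuous G' →
      (∀ n x, dist (g n x) (G x) ≤ C / 2 ^ n) →
      (∀ n x, dist ((g n).symm x) (G' x) ≤ C / 2 ^ n) → ∀ x, G' (G x) = x := by
    intro g G G' hc hG hG' x
    have t1 : Tendsto (fun n => g n x) atTop (𝓝 (G x)) :=
      tendsto_iff_dist_tendsto_zero.2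
        (squeeze_zero (fun _ => dist_nonneg) (fun n => hG n x) ht)
    have t2 := (hc.tendsto (G x)).comp t1
    refine tendsto_nhds_unique t2 (tendsto_iff_dist_tendsto_zero.2
      (squeeze_zero (fun _ => dist_nonneg) (fun n => ?_) ht))
    have := hG' n (g n x)
    rwa [Homeomorph.symm_apply_apply, dist_comm] at this
  obtain ⟨F, hFc, hF⟩ := lim f h1
  obtain ⟨F', hFc', hF'⟩ := lim (fun n => (f n).symm) h2
  exact ⟨{  toFun := F
            invFun := F'
            left_inv := inv f F F' hFc' hF hF'
            right_inv := inv (fun n => (f n).symm) F' F hFc hF' hF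
            continuous_toFun := hFc
            continuous_invFun := hFc' }, hF⟩

/-- The images of `m` under `h` and of `m'` under `k` agree on the members of `𝒞`, which are
disjoint open rectangles filling `Q` up to null sets. -/
structure Matched (Q : Set (ℝ × ℝ)) (m m' : Measure (ℝ × ℝ)) (h k : ℝ × ℝ ≃ₜ ℝ × ℝ)
    (𝒞 : Set (Set (ℝ × ℝ))) : Prop where
  finite : 𝒞.Finite
  disjoint : 𝒞.PairwiseDisjoint id
  rect : ∀ E ∈ 𝒞, IsOpenRect E
  subset : ⋃₀ 𝒞 ⊆ Q
  eq : ∀ E ∈ 𝒞, m (h ⁻¹' E) = m' (k ⁻¹' E)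
  null_left : m (h ⁻¹' (Q \ ⋃₀ 𝒞)) = 0
  null_right : m' (k ⁻¹' (Q \ ⋃₀ 𝒞)) = 0
  id_left : ∀ x, x ∉ Q → h x = x
  id_right : ∀ x, x ∉ Q → k x = x

theorem Matched.symm {Q : Set (ℝ × ℝ)} {m m' : Measure (ℝ × ℝ)} {h k : ℝ × ℝ ≃ₜ ℝ × ℝ}
    {𝒞 : Set (Set (ℝ × ℝ))} (H : Matched Q m m' h k 𝒞) : Matched Q m' m k h 𝒞 :=
  ⟨H.finite, H.disjoint, H.rect, H.subset, fun E hE => (H.eq E hE).symm, H.null_right,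
    H.null_left, H.id_right, H.id_left⟩

theorem homeomorph_mem_iff {Q : Set (ℝ × ℝ)} {h : ℝ × ℝ ≃ₜ ℝ × ℝ}
    (hQ : ∀ x, x ∉ Q → h x = x) (x : ℝ × ℝ) : h x ∈ Q ↔ x ∈ Q :=
  (movesWithin_singleton hQ).mem_iff (by rw [sUnion_singleton])

/-- The members of `𝒞` and their preimages under `k` have diameter at most `ε`. -/
def SmallCells (k : ℝ × ℝ ≃ₜ ℝ × ℝ) (𝒞 : Set (Set (ℝ × ℝ))) (ε : ℝ) : Prop :=
  ∀ E ∈ 𝒞, ∀ x ∈ E, ∀ y ∈ E, dist x y ≤ ε ∧ dist (k.symm x) (k.symm y) ≤ ε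

theorem SmallCells.dist_trans_le {h u : ℝ × ℝ ≃ₜ ℝ × ℝ} {𝒞 : Set (Set (ℝ × ℝ))} {ε : ℝ}
    (hε : 0 ≤ ε) (hs : SmallCells h 𝒞 ε) (hu : MovesWithin u 𝒞) (x : ℝ × ℝ) :
    dist (h x) (h.trans u x) ≤ ε ∧ dist (h.symm x) ((h.trans u).symm x) ≤ ε := by
  constructor
  · rw [Homeomorph.trans_apply]
    rcases hu (h x) with h1 | ⟨D, hD, h1, h2⟩
    · rwa [h1, dist_self]
    · exact (hs D hD _ h1 _ h2).1
  · rw [Homeomorph.symm_trans_apply]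
    rcases hu (u.symm x) with h1 | ⟨D, hD, h1, h2⟩
    · rw [Homeomorph.apply_symm_apply] at h1
      rwa [← h1, dist_self]
    · rw [Homeomorph.apply_symm_apply] at h2
      exact (hs D hD _ h2 _ h1).2

theorem measure_preimage_sUnion {𝒞 : Set (Set (ℝ × ℝ))} (hf : 𝒞.Finite)
    (hd : 𝒞.PairwiseDisjoint id) (ho : ∀ E ∈ 𝒞, IsOpen E) (m : Measure (ℝ × ℝ))
    (h : ℝ × ℝ ≃ₜ ℝ × ℝ) : m (h ⁻¹' ⋃₀ 𝒞) = ∑' E : 𝒞, m (h ⁻¹' E) := by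
  rw [preimage_sUnion, measure_biUnion hf.countable]
  · exact fun E hE F hF hne => (hd hE hF hne).preimage h
  · exact fun E hE => ((ho E hE).preimage h.continuous).measurableSet

theorem Matched.exists_refinement {Q : Set (ℝ × ℝ)} {m m' : Measure (ℝ × ℝ)}
    [IsFiniteMeasure m] [IsFiniteMeasure m'] [NullSingletonClass m] [NullSingletonClass m']
    (hQb : Bornology.IsBounded Q) (hm : PositiveOn m Q) (hm' : PositiveOn m' Q)
    (hQ : m Q = m' Q) {h k : ℝ × ℝ ≃ₜ ℝ × ℝ} {𝒞 : Set (Set (ℝ × ℝ))}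
    (H : Matched Q m m' h k 𝒞) {ε : ℝ} (hε : 0 < ε) :
    ∃ (u : ℝ × ℝ ≃ₜ ℝ × ℝ) (𝒞' : Set (Set (ℝ × ℝ))), MovesWithin u 𝒞 ∧
      Matched Q m m' (h.trans u) k 𝒞' ∧ SmallCells k 𝒞' ε := by
  obtain ⟨δ, hδ, hkδ⟩ := Metric.uniformContinuousOn_iff.1
    ((hQb.isCompact_closure).uniformContinuousOn_of_continuous k.symm.continuous.continuousOn) ε hε
  have := nullSingletonClass_map (m := m) h
  have := nullSingletonClass_map (m := m') k
  obtain ⟨u, hu, 𝒞', hf, hd, hE, hn⟩ := refinable_of_finite (ε := min ε (δ / 2))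
    (lt_min hε (half_pos hδ)) (m.map h) (m'.map k) H.finite H.disjoint (fun D hD => by
      have hDQ : D ⊆ Q := (subset_sUnion_of_mem hD).trans H.subset
      refine ⟨H.rect D hD,
        (hm.map h fun x => (homeomorph_mem_iff H.id_left x).1).mono hDQ,
        (hm'.map k fun x => (homeomorph_mem_iff H.id_right x).1).mono hDQ, ?_⟩
      rw [h.measurableEmbedding.map_apply, k.measurableEmbedding.map_apply, H.eq D hD])
  have hsub : ⋃₀ 𝒞' ⊆ Q := (sUnion_subset fun E hE' => (hE E hE').2.1).trans H.subset
  have hid : ∀ x, x ∉ Q → h.trans u x = x := fun x hx => by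
    rw [Homeomorph.trans_apply, H.id_left x hx]
    exact hu.eq_of_notMem fun h => hx (H.subset h)
  have heq : ∀ E ∈ 𝒞', m (h.trans u ⁻¹' E) = m' (k ⁻¹' E) := fun E hE' => by
    have := (hE E hE').2.2.2
    rwa [h.measurableEmbedding.map_apply, k.measurableEmbedding.map_apply] at this
  have hopen : ∀ E ∈ 𝒞', IsOpen E := fun E hE' => (hE E hE').1.isOpen
  have hnull : m' (k ⁻¹' (Q \ ⋃₀ 𝒞')) = 0 := by
    rw [k.measurableEmbedding.map_apply] at hn
    refine measure_mono_null (fun x hx => ?_) (measure_union_null H.null_right hn)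
    by_cases hx' : k x ∈ ⋃₀ 𝒞
    · exact Or.inr ⟨hx', hx.2⟩
    · exact Or.inl ⟨hx.1, hx'⟩
  refine ⟨u, 𝒞', hu, ⟨hf, hd, fun E hE' => (hE E hE').1, hsub, heq, ?_, hnull, hid, H.id_right⟩,
    fun E hE' x hx y hy => ?_⟩
  · have hUo : IsOpen (⋃₀ 𝒞') := isOpen_sUnion hopen
    have key : ∀ (n : Measure (ℝ × ℝ)) [IsFiniteMeasure n] (g : ℝ × ℝ ≃ₜ ℝ × ℝ),
        (∀ x, x ∉ Q → g x = x) → n (g ⁻¹' (Q \ ⋃₀ 𝒞')) = n Q - n (g ⁻¹' ⋃₀ 𝒞') := by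
      intro n _ g hg
      have hpre : g ⁻¹' Q = Q := Set.ext fun x => homeomorph_mem_iff hg x
      rw [preimage_sdiff, measure_sdiff (preimage_mono hsub)
        (hUo.preimage g.continuous).measurableSet.nullMeasurableSet (measure_ne_top _ _), hpre]
    rw [key m _ hid, hQ, ← hnull, key m' k H.id_right, measure_preimage_sUnion hf hd hopen,
      measure_preimage_sUnion hf hd hopen]
    congr 2
    funext E
    exact heq E E.2
  · have hxy := (hE E hE').2.2.1 x hx y hy
    refine ⟨hxy.trans (min_le_left _ _), (hkδ x (subset_closure (hsub ⟨E, hE', hx⟩)) y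
      (subset_closure (hsub ⟨E, hE', hy⟩)) ?_).le⟩
    linarith [hxy.trans (min_le_right _ _)]

theorem Matched.measure_preimage_le {Q : Set (ℝ × ℝ)} {m m' : Measure (ℝ × ℝ)}
    (hmQ : m Qᶜ = 0) {h k : ℝ × ℝ ≃ₜ ℝ × ℝ} {𝒞 : Set (Set (ℝ × ℝ))}
    (H : Matched Q m m' h k 𝒞) {ε δ : ℝ}
    (hs : ∀ E ∈ 𝒞, ∀ x ∈ E, ∀ y ∈ E, dist x y ≤ ε) (hε : 0 ≤ ε) (hδ : 0 ≤ δ)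
    (F : Set (ℝ × ℝ)) :
    m (h ⁻¹' Metric.cthickening δ F) ≤ m' (k ⁻¹' Metric.cthickening (ε + δ) F) := by
  set 𝒯 : Set (Set (ℝ × ℝ)) := {E ∈ 𝒞 | (E ∩ Metric.cthickening δ F).Nonempty} with h𝒯
  have hsub : 𝒯 ⊆ 𝒞 := fun E hE => hE.1
  have ho : ∀ E ∈ 𝒯, IsOpen E := fun E hE => (H.rect E hE.1).isOpen
  have h1 : m (h ⁻¹' Metric.cthickening δ F) ≤ m (h ⁻¹' ⋃₀ 𝒯) := by
    rw [← add_zero (m (h ⁻¹' ⋃₀ 𝒯)), ← measure_union_null hmQ H.null_left]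
    refine (measure_mono fun x hx => ?_).trans (measure_union_le _ _)
    by_cases hxQ : x ∈ Q
    · by_cases hx𝒞 : h x ∈ ⋃₀ 𝒞
      · obtain ⟨E, hE, hxE⟩ := hx𝒞
        exact Or.inl ⟨E, ⟨hE, h x, hxE, hx⟩, hxE⟩
      · exact Or.inr (Or.inr ⟨(homeomorph_mem_iff H.id_left x).2 hxQ, hx𝒞⟩)
    · exact Or.inr (Or.inl hxQ)
  have h2 : m (h ⁻¹' ⋃₀ 𝒯) = m' (k ⁻¹' ⋃₀ 𝒯) := by
    rw [measure_preimage_sUnion (H.finite.subset hsub) (H.disjoint.subset hsub) ho,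
      measure_preimage_sUnion (H.finite.subset hsub) (H.disjoint.subset hsub) ho]
    congr 1
    funext E
    exact H.eq E E.2.1
  refine h1.trans (h2.le.trans (measure_mono (preimage_mono ?_)))
  rintro x ⟨E, ⟨hE, y, hyE, hy⟩, hxE⟩
  refine Metric.cthickening_cthickening_subset hε hδ F ?_
  exact Metric.mem_cthickening_of_dist_le x y ε _ hy (hs E hE x hxE y hyE)

theorem exists_matched_sequence {Q : Set (ℝ × ℝ)} {m m' : Measure (ℝ × ℝ)}
    [IsFiniteMeasure m] [IsFiniteMeasure m'] [NullSingletonClass m] [NullSingletonClass m']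
    (hQr : IsOpenRect Q) (hQb : Bornology.IsBounded Q) (hm : PositiveOn m Q)
    (hm' : PositiveOn m' Q) (hQ : m Q = m' Q) {C : ℝ} (hC : 0 < C)
    (hdiam : ∀ x ∈ Q, ∀ y ∈ Q, dist x y ≤ C / 2) :
    ∃ (h k : ℕ → ℝ × ℝ ≃ₜ ℝ × ℝ) (𝒞 : ℕ → Set (Set (ℝ × ℝ))),
      (∀ n, Matched Q m m' (h n) (k n) (𝒞 n)) ∧ (∀ n, SmallCells (h n) (𝒞 n) (C / 2 / 2 ^ n)) ∧
      (∀ n x, dist (h n x) (h (n + 1) x) ≤ C / 2 / 2 ^ n ∧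
        dist ((h n).symm x) ((h (n + 1)).symm x) ≤ C / 2 / 2 ^ n) ∧
      (∀ n x, dist (k n x) (k (n + 1) x) ≤ C / 2 / 2 ^ n ∧
        dist ((k n).symm x) ((k (n + 1)).symm x) ≤ C / 2 / 2 ^ n) := by
  have hpos : ∀ n : ℕ, 0 < C / 2 / 2 ^ n := fun n => by positivity
  let S (n : ℕ) := {s : (ℝ × ℝ ≃ₜ ℝ × ℝ) × (ℝ × ℝ ≃ₜ ℝ × ℝ) × Set (Set (ℝ × ℝ)) //
    Matched Q m m' s.1 s.2.1 s.2.2 ∧ SmallCells s.1 s.2.2 (C / 2 / 2 ^ n)}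
  have start : Nonempty (S 0) := by
    refine ⟨⟨(Homeomorph.refl _, Homeomorph.refl _, {Q}), ⟨finite_singleton _,
      pairwiseDisjoint_singleton _ _, ?_, by simp, ?_, by simp, by simp, fun _ _ => rfl,
      fun _ _ => rfl⟩, ?_⟩⟩
    · rintro E rfl
      exact hQr
    · rintro E rfl
      exact hQ
    · rintro E rfl x hx y hy
      simpa using hdiam x hx y hy
  have step : ∀ n (s : S n), ∃ t : S (n + 1),
      (∀ x, dist (s.1.1 x) (t.1.1 x) ≤ C / 2 / 2 ^ n ∧
        dist (s.1.1.symm x) (t.1.1.symm x) ≤ C / 2 / 2 ^ n) ∧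
      (∀ x, dist (s.1.2.1 x) (t.1.2.1 x) ≤ C / 2 / 2 ^ n ∧
        dist (s.1.2.1.symm x) (t.1.2.1.symm x) ≤ C / 2 / 2 ^ n) := by
    rintro n ⟨⟨h, k, 𝒞⟩, hM, hs⟩
    obtain ⟨u, 𝒞', hu, hM', hs'⟩ := hM.exists_refinement hQb hm hm' hQ (hpos n)
    obtain ⟨v, 𝒞'', hv, hM'', hs''⟩ :=
      hM'.symm.exists_refinement hQb hm' hm hQ.symm (hpos (n + 1))
    exact ⟨⟨(h.trans u, k.trans v, 𝒞''), hM''.symm, hs''⟩, hs.dist_trans_le (hpos n).le hu,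
      hs'.dist_trans_le (hpos n).le hv⟩
  choose next hnext using step
  let seq : ∀ n, S n := fun n => Nat.rec start.some (fun n s => next n s) n
  exact ⟨fun n => (seq n).1.1, fun n => (seq n).1.2.1, fun n => (seq n).1.2.2,
    fun n => (seq n).2.1, fun n => (seq n).2.2, fun n => (hnext n (seq n)).1,
    fun n => (hnext n (seq n)).2⟩

theorem measure_preimage_le_of_forall_cthickening {m m' : Measure (ℝ × ℝ)}
    [IsFiniteMeasure m'] {h k : ℕ → ℝ × ℝ ≃ₜ ℝ × ℝ} {F G : ℝ × ℝ ≃ₜ ℝ × ℝ} {C : ℝ} (hC : 0 < C)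
    (hF : ∀ n x, dist (h n x) (F x) ≤ C / 2 ^ n) (hG : ∀ n x, dist (k n x) (G x) ≤ C / 2 ^ n)
    (hle : ∀ n (δ : ℝ) (T : Set (ℝ × ℝ)), 0 ≤ δ →
      m (h n ⁻¹' Metric.cthickening δ T) ≤
        m' (k n ⁻¹' Metric.cthickening (C / 2 / 2 ^ n + δ) T))
    {T : Set (ℝ × ℝ)} (hT : IsClosed T) : m.map F T ≤ m'.map G T := by
  have ht : Tendsto (fun n : ℕ => C / (2 : ℝ) ^ n + (C / 2 / 2 ^ n + C / 2 ^ n)) atTop (𝓝 0) := by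
    have : ∀ c : ℝ, Tendsto (fun n : ℕ => c / (2 : ℝ) ^ n) atTop (𝓝 0) := fun c =>
      tendsto_const_nhds.div_atTop (tendsto_pow_atTop_atTop_of_one_lt one_lt_two)
    simpa using (this C).add ((this (C / 2)).add (this C))
  refine ge_of_tendsto' ((tendsto_measure_cthickening_of_isClosed (μ := m'.map G)
    ⟨1, one_pos, measure_ne_top _ _⟩ hT).comp ht) fun n => ?_
  have hr : 0 < C / (2 : ℝ) ^ n := by positivity
  rw [Function.comp_apply, F.measurableEmbedding.map_apply, G.measurableEmbedding.map_apply]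
  calc m (F ⁻¹' T) ≤ m (h n ⁻¹' Metric.cthickening (C / 2 ^ n) T) :=
        measure_mono fun x hx => Metric.mem_cthickening_of_dist_le _ (F x) _ _ hx (hF n x)
    _ ≤ m' (k n ⁻¹' Metric.cthickening (C / 2 / 2 ^ n + C / 2 ^ n) T) := hle n _ T hr.le
    _ ≤ m' (G ⁻¹' Metric.cthickening (C / 2 ^ n + (C / 2 / 2 ^ n + C / 2 ^ n)) T) :=
      measure_mono fun x hx => Metric.cthickening_cthickening_subset hr.le
        (by positivity) T (Metric.mem_cthickening_of_dist_le (G x) (k n x) _ _ hx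
          (by rw [dist_comm]; exact hG n x))

/-- Two diffuse finite measures of the same mass on a bounded open rectangle which charge every
nonempty open subset are conjugate by a homeomorphism supported in the rectangle. -/
theorem exists_homeomorph_map_eq {Q : Set (ℝ × ℝ)} {m m' : Measure (ℝ × ℝ)}
    [IsFiniteMeasure m] [IsFiniteMeasure m'] [NullSingletonClass m] [NullSingletonClass m']
    (hQr : IsOpenRect Q) (hQb : Bornology.IsBounded Q) (hm : PositiveOn m Q)
    (hm' : PositiveOn m' Q) (hQ : m Q = m' Q) (hmQ : m Qᶜ = 0) (hmQ' : m' Qᶜ = 0) :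
    ∃ G : ℝ × ℝ ≃ₜ ℝ × ℝ, (∀ x, x ∉ Q → G x = x) ∧ m.map G = m' := by
  obtain ⟨C, hC, hdiam⟩ : ∃ C : ℝ, 0 < C ∧ ∀ x ∈ Q, ∀ y ∈ Q, dist x y ≤ C / 2 := by
    obtain ⟨C, hC⟩ := Metric.isBounded_iff.1 hQb
    exact ⟨2 * max C 1, by positivity, fun x hx y hy =>
      (hC hx hy).trans (by linarith [le_max_left C 1])⟩
  obtain ⟨h, k, 𝒞, hM, hs, hh, hk⟩ := exists_matched_sequence hQr hQb hm hm' hQ hC hdiam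
  obtain ⟨F, hF⟩ := exists_homeomorph_limit C h (fun n x => (hh n x).1) fun n x => (hh n x).2
  obtain ⟨G, hG⟩ := exists_homeomorph_limit C k (fun n x => (hk n x).1) fun n x => (hk n x).2
  have fix : ∀ (g : ℕ → ℝ × ℝ ≃ₜ ℝ × ℝ) (L : ℝ × ℝ ≃ₜ ℝ × ℝ),
      (∀ n x, dist (g n x) (L x) ≤ C / 2 ^ n) → (∀ n x, x ∉ Q → g n x = x) →
      ∀ x, x ∉ Q → L x = x := by
    intro g L hL hg x hx
    have ht : Tendsto (fun n : ℕ => C / (2 : ℝ) ^ n) atTop (𝓝 0) :=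
      tendsto_const_nhds.div_atTop (tendsto_pow_atTop_atTop_of_one_lt one_lt_two)
    have : dist x (L x) ≤ 0 := ge_of_tendsto' ht fun n => by
      have := hL n x
      rwa [hg n x hx] at this
    exact (dist_le_zero.1 this).symm
  have hF' := fix h F hF fun n => (hM n).id_left
  have hG' := fix k G hG fun n => (hM n).id_right
  have hclosed : ∀ T, IsClosed T → m.map F T = m'.map G T := by
    intro T hT
    have hcell : ∀ n, ∀ E ∈ 𝒞 n, ∀ x ∈ E, ∀ y ∈ E, dist x y ≤ C / 2 / 2 ^ n :=
      fun n E hE x hx y hy => (hs n E hE x hx y hy).1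
    refine le_antisymm
      (measure_preimage_le_of_forall_cthickening hC hF hG (fun n δ T hδ => ?_) hT)
      (measure_preimage_le_of_forall_cthickening hC hG hF (fun n δ T hδ => ?_) hT)
    · exact (hM n).measure_preimage_le hmQ (hcell n) (by positivity) hδ T
    · exact (hM n).symm.measure_preimage_le hmQ' (hcell n) (by positivity) hδ T
  have hFG : m.map F = m'.map G := by
    refine ext_of_generate_finite _ ?_ isPiSystem_isClosed (fun T hT => hclosed T hT)
      (hclosed _ isClosed_univ)
    rw [BorelSpace.measurable_eq (α := ℝ × ℝ), borel_eq_generateFrom_isClosed]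
  refine ⟨F.trans G.symm, fun x hx => ?_, ?_⟩
  · rw [Homeomorph.trans_apply, hF' x hx, Homeomorph.symm_apply_eq, hG' x hx]
  · have : m.map (F.trans G.symm) = (m.map F).map G.symm :=
      (Measure.map_map G.symm.measurable F.measurable).symm
    rw [this, hFG, Measure.map_map G.symm.measurable G.measurable]
    simp

/-- Two diffuse finite measures of the same mass on the one-point compactification of the plane
(transported to a space `S`) which charge every nonempty open set are conjugate. -/
theorem exists_homeomorph_map_eq_of_onePoint {S : Type*} [TopologicalSpace S] [T2Space S]
    [MeasurableSpace S] [BorelSpace S] (s : OnePoint (ℝ × ℝ) ≃ₜ S) (μ μ' : Measure S)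
    [IsFiniteMeasure μ] [IsFiniteMeasure μ'] [NullSingletonClass μ] [NullSingletonClass μ']
    [μ.IsOpenPosMeasure] [μ'.IsOpenPosMeasure] (hμ : μ univ = μ' univ) :
    ∃ h : S ≃ₜ S, μ.map h = μ' := by
  set ι : ℝ × ℝ → S := fun x => s x with hι
  have hιo : IsOpenEmbedding ι := s.isOpenEmbedding.comp OnePoint.isOpenEmbedding_coe
  have hιm : MeasurableEmbedding ι := hιo.measurableEmbedding
  have hrange : (range ι)ᶜ = {s OnePoint.infty} := by
    rw [hι, show (fun x : ℝ × ℝ => s x) = s ∘ ((↑) : ℝ × ℝ → OnePoint (ℝ × ℝ)) from rfl, range_comp,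
      ← image_compl_eq s.bijective, OnePoint.compl_range_coe, image_singleton]
  have hback : ∀ (n : Measure S) [NullSingletonClass n], (n.comap ι).map ι = n := by
    intro n _
    rw [hιm.map_comap]
    refine Measure.restrict_eq_self_of_ae_mem ?_
    rw [ae_iff]
    change n (range ι)ᶜ = 0
    rw [hrange, measure_singleton]
  set β : ℝ × ℝ → ℝ × ℝ := fun x => (Homeomorph.unitBall x : ℝ × ℝ) with hβ
  have hβo : IsOpenEmbedding β :=
    Metric.isOpen_ball.isOpenEmbedding_subtypeVal.comp Homeomorph.unitBall.isOpenEmbedding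
  have hβm : MeasurableEmbedding β := hβo.measurableEmbedding
  set Q : Set (ℝ × ℝ) := Metric.ball 0 1 with hQdef
  have hβQ : ∀ x, β x ∈ Q := fun x => (Homeomorph.unitBall x).2
  have hQr : IsOpenRect Q := by
    refine ⟨-1, 1, -1, 1, by norm_num, by norm_num, ?_⟩
    rw [hQdef, ← Prod.mk_zero_zero, ← ball_prod_same, Real.ball_eq_Ioo]
    norm_num
  have hfin : ∀ (n : Measure S) [IsFiniteMeasure n], IsFiniteMeasure ((n.comap ι).map β) := by
    intro n _
    infer_instance
  have hnull : ∀ (n : Measure S) [NullSingletonClass n],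
      NullSingletonClass ((n.comap ι).map β) := fun n _ => ⟨fun x => by
    rw [hβm.map_apply, hιm.comap_apply]
    exact ((subsingleton_singleton.preimage hβm.injective).image ι).measure_zero n⟩
  have hpos : ∀ (n : Measure S) [n.IsOpenPosMeasure], PositiveOn ((n.comap ι).map β) Q := by
    intro n _ U hU hUQ hne
    rw [hβm.map_apply, hιm.comap_apply]
    refine (hιo.isOpenMap _ (hU.preimage hβo.continuous)).measure_pos n ?_
    obtain ⟨y, hy⟩ := hne
    refine ⟨_, ⟨Homeomorph.unitBall.symm ⟨y, hUQ hy⟩, ?_, rfl⟩⟩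
    simpa [hβ] using hy
  have hQ : ∀ (n : Measure S) [NullSingletonClass n], ((n.comap ι).map β) Q = n univ := by
    intro n _
    rw [hβm.map_apply, show β ⁻¹' Q = ι ⁻¹' univ from by
      rw [preimage_univ]; exact eq_univ_of_forall hβQ, ← hιm.map_apply, hback]
  have hQc : ∀ n : Measure S, ((n.comap ι).map β) Qᶜ = 0 := by
    intro n
    rw [hβm.map_apply, show β ⁻¹' Qᶜ = ∅ from eq_empty_of_forall_notMem fun x hx => hx (hβQ x),
      measure_empty]
  have := hfin μ
  have := hfin μ'
  have := hnull μ
  have := hnull μ'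
  obtain ⟨G, hG, hGm⟩ := exists_homeomorph_map_eq hQr Metric.isBounded_ball (hpos μ) (hpos μ')
    (by rw [hQ μ, hQ μ', hμ]) (hQc μ) (hQc μ')
  let G₀ : ℝ × ℝ ≃ₜ ℝ × ℝ := (Homeomorph.unitBall.trans
    (G.subtype fun x => (homeomorph_mem_iff hG x).symm)).trans Homeomorph.unitBall.symm
  have hβG : β ∘ G₀ = G ∘ β := by
    funext x
    simp [hβ, G₀]
  have hG₀ : (μ.comap ι).map G₀ = μ'.comap ι := by
    rw [Measure.map_map G.measurable hβm.measurable, ← hβG,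
      ← Measure.map_map hβm.measurable G₀.measurable] at hGm
    rw [← hβm.comap_map ((μ.comap ι).map G₀), hGm, hβm.comap_map]
  refine ⟨(s.symm.trans G₀.onePointCongr).trans s, ?_⟩
  have hcomm : ⇑((s.symm.trans G₀.onePointCongr).trans s) ∘ ι = ι ∘ G₀ := by
    funext x
    simp [hι]
  conv_lhs => rw [← hback μ]
  rw [Measure.map_map (Homeomorph.measurable _) hιm.measurable, hcomm,
    ← Measure.map_map hιm.measurable G₀.measurable, hG₀, hback]

theorem nullSingletonClass_toSphere {E : Type*} [NormedAddCommGroup E] [NormedSpace ℝ E]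
    [MeasurableSpace E] [BorelSpace E] [FiniteDimensional ℝ E] (μ : Measure E)
    [μ.IsAddHaarMeasure] (hE : 1 < Module.finrank ℝ E) : NullSingletonClass μ.toSphere := by
  refine ⟨fun x => ?_⟩
  rw [Measure.toSphere_apply' _ (measurableSet_singleton x), image_singleton]
  refine mul_eq_zero_of_right _ (measure_mono_null ?_
    (Measure.addHaar_submodule μ (Submodule.span ℝ {(x : E)}) fun h => ?_))
  · rintro _ ⟨r, -, _, rfl, rfl⟩
    exact Submodule.smul_mem _ _ (Submodule.mem_span_singleton_self _)
  · have := finrank_span_le_card (R := ℝ) ({(x : E)} : Set E)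
    rw [h, finrank_top, toFinset_singleton, Finset.card_singleton] at this
    omega

/-- Lemma 3.5 (Oxtoby–Ulam on the 2-sphere): a finite Borel measure `μ` on `S²` without
atoms and positive on nonempty open sets is topologically conjugate to the rescaled
surface (Lebesgue) measure `σ`: there is a homeomorphism `h` of `S²` with
`h_* μ = (μ(S²)/σ(S²)) • σ`. -/
theorem sphere_measure_topologically_conjugate_to_lebesgue
    (μ : Measure (Metric.sphere (0 : EuclideanSpace ℝ (Fin 3)) 1))
    (hfin : IsFiniteMeasure μ)
    (hatoms : ∀ x : Metric.sphere (0 : EuclideanSpace ℝ (Fin 3)) 1, μ {x} = 0)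
    (hopen : ∀ U : Set (Metric.sphere (0 : EuclideanSpace ℝ (Fin 3)) 1),
      IsOpen U → U.Nonempty → 0 < μ U) :
    ∃ h : Metric.sphere (0 : EuclideanSpace ℝ (Fin 3)) 1 ≃ₜ
        Metric.sphere (0 : EuclideanSpace ℝ (Fin 3)) 1,
      Measure.map h μ =
        (μ Set.univ / (volume : Measure (EuclideanSpace ℝ (Fin 3))).toSphere Set.univ) •
          (volume : Measure (EuclideanSpace ℝ (Fin 3))).toSphere := by
  set σ := (volume : Measure (EuclideanSpace ℝ (Fin 3))).toSphere with hσ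
  have : NullSingletonClass σ := nullSingletonClass_toSphere _ (by simp)
  have : NullSingletonClass μ := ⟨hatoms⟩
  have : μ.IsOpenPosMeasure := ⟨fun U hU hne => (hopen U hU hne).ne'⟩
  let s : OnePoint (ℝ × ℝ) ≃ₜ Metric.sphere (0 : EuclideanSpace ℝ (Fin 3)) 1 :=
    onePointEquivSphereOfFinrankEq (by simp)
  have hne : Nonempty (Metric.sphere (0 : EuclideanSpace ℝ (Fin 3)) 1) := ⟨s OnePoint.infty⟩
  have hσ0 : σ univ ≠ 0 := isOpen_univ.measure_ne_zero σ univ_nonempty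
  have hσt : σ univ ≠ ∞ := measure_ne_top _ _
  have hμ0 : μ univ ≠ 0 := isOpen_univ.measure_ne_zero μ univ_nonempty
  have hc0 : μ univ / σ univ ≠ 0 := ENNReal.div_ne_zero.2 ⟨hμ0, hσt⟩
  have hct : μ univ / σ univ ≠ ∞ := ENNReal.div_ne_top (measure_ne_top _ _) hσ0
  have : IsFiniteMeasure ((μ univ / σ univ) • σ) := σ.smul_finite hct
  have : NullSingletonClass ((μ univ / σ univ) • σ) := ⟨fun x => by simp⟩
  have : ((μ univ / σ univ) • σ).IsOpenPosMeasure := ⟨fun U hU hne => by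
    rw [Measure.smul_apply, smul_eq_mul]
    exact mul_ne_zero hc0 (hU.measure_ne_zero σ hne)⟩
  exact exists_homeomorph_map_eq_of_onePoint s μ _ (by
    rw [Measure.smul_apply, smul_eq_mul, ENNReal.div_mul_cancel hσ0 hσt])
end

section
/- Let a ≥ 0, x ∈ ℝ and (ξ₁, ξ₂) ∈ ℝ² with (ξ₁, ξ₂) ≠ (0, 0). If f₀(a) ≤ f₀(x) · ξ₁ / √(ξ₁² + ξ₂²), then |x| ≤ a. -/
open Real

theorem two_mul_exp_div_one_add_exp_two_mul (t : ℝ) :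
    2 * exp t / (1 + exp (2 * t)) = (cosh t)⁻¹ := by
  have h : exp (2 * t) = exp t * exp t := by rw [← exp_add, two_mul]
  have hpos : 0 < exp t := exp_pos t
  rw [cosh_eq, exp_neg, h]
  field_simp
  ring

theorem div_sqrt_sq_add_sq_le_one (u v : ℝ) : u / √(u ^ 2 + v ^ 2) ≤ 1 :=
  div_le_one_of_le₀ (le_sqrt_of_sq_le (le_add_of_nonneg_right (sq_nonneg v))) (sqrt_nonneg _)

/-- Invariance estimate from Lemma 2.2: if `f₀(a) ≤ f₀(x) · ξ₁ / √(ξ₁² + ξ₂²)` for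
`a ≥ 0` and `(ξ₁, ξ₂) ≠ (0, 0)`, then `|x| ≤ a`, where `f₀(t) = 2eᵗ/(1 + e^{2t})`. -/
theorem f0_cone_invariance_estimate
    (f₀ : ℝ → ℝ) (hf₀ : ∀ t : ℝ, f₀ t = 2 * exp t / (1 + exp (2 * t)))
    (a x ξ₁ ξ₂ : ℝ) (ha : 0 ≤ a) (hξ : (ξ₁, ξ₂) ≠ (0, 0))
    (hineq : f₀ a ≤ f₀ x * ξ₁ / Real.sqrt (ξ₁ ^ 2 + ξ₂ ^ 2)) :
    |x| ≤ a := by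
  simp only [hf₀, two_mul_exp_div_one_add_exp_two_mul, mul_div_assoc (cosh x)⁻¹] at hineq
  have h : (cosh a)⁻¹ ≤ (cosh x)⁻¹ := hineq.trans <|
    mul_le_of_le_one_right (inv_nonneg.2 (cosh_pos x).le) (div_sqrt_sq_add_sq_le_one ξ₁ ξ₂)
  rw [inv_le_inv₀ (cosh_pos a) (cosh_pos x), cosh_le_cosh, abs_of_nonneg ha] at h
  exact h
end
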